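/- arXiv:2005.01466 — 2 statements merged into one kernel-verified Lean document; each statement's English description precedes it below -/
import Mathlib

section
/- Let D be a strongly connected balanced bipartite digraph of order 2a with a ≥ 3, and let k be an integer with max{1, a/4} < k ≤ a/2. Suppose for every dominating pair {u,v}: either d(u) ≥ 2a−k and d(v) ≥ a+k, or d(u) ≥ a+k and d(v) ≥ 2a−k. Then D is either bipancyclic or a directed cycle of length 2a. -/
open Finset Function

variable {V : Type*}

/-- Out-degree of a vertex in a digraph given by arc relation `A`. -/
noncomputable def outDeg (A : V → V → Prop) (u : V) : ℕ := {v | A u v}.ncard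

/-- In-degree of a vertex. -/
noncomputable def inDeg (A : V → V → Prop) (u : V) : ℕ := {v | A v u}.ncard

/-- Degree `d(u) = d⁺(u) + d⁻(u)`. -/
noncomputable def deg (A : V → V → Prop) (u : V) : ℕ := outDeg A u + inDeg A u

/-- Strong connectedness: a directed path between every ordered pair of vertices. -/
def StronglyConnected (A : V → V → Prop) : Prop :=
  ∀ u v : V, Relation.ReflTransGen A u v

/-- `X, Y` form a bipartition of the digraph `A`. -/
def IsBipartition (A : V → V → Prop) (X Y : Set V) : Prop :=
  Disjoint X Y ∧ X ∪ Y = Set.univ ∧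
    ∀ u v, A u v → (u ∈ X ∧ v ∈ Y) ∨ (u ∈ Y ∧ v ∈ X)

/-- `{u,v}` is a dominating pair: a common out-neighbour exists. -/
def IsDominatingPair (A : V → V → Prop) (u v : V) : Prop :=
  u ≠ v ∧ ∃ w, A u w ∧ A v w

/-- `{u,v}` is a dominated pair: a common in-neighbour exists. -/
def IsDominatedPair (A : V → V → Prop) (u v : V) : Prop :=
  u ≠ v ∧ ∃ w, A w u ∧ A w v

/-- The digraph contains a directed cycle of length `l`. -/
def HasCycleOfLength (A : V → V → Prop) (l : ℕ) : Prop :=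
  ∃ f : ZMod l → V, Function.Injective f ∧ ∀ i, A (f i) (f (i + 1))

/-- The digraph contains a Hamiltonian (directed) cycle. -/
def IsHamiltonian [Fintype V] (A : V → V → Prop) : Prop :=
  ∃ f : ZMod (Fintype.card V) ≃ V, ∀ i, A (f i) (f (i + 1))

/-- The digraph is exactly one directed cycle through all its vertices. -/
def IsDirectedCycleDigraph [Fintype V] (A : V → V → Prop) : Prop :=
  ∃ f : ZMod (Fintype.card V) ≃ V, ∀ u v, A u v ↔ ∃ i, u = f i ∧ v = f (i + 1)

/-- A balanced bipartite digraph of order `2a` is bipancyclic: it has cycles of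
all even lengths `2, 4, …, 2a`. -/
def Bipancyclic [Fintype V] (A : V → V → Prop) (a : ℕ) : Prop :=
  ∀ l, 1 ≤ l → l ≤ a → HasCycleOfLength A (2 * l)

/-- A digraph is pancyclic: cycles of all lengths `2, …, n`. -/
def Pancyclic [Fintype V] (A : V → V → Prop) : Prop :=
  ∀ l, 2 ≤ l → l ≤ Fintype.card V → HasCycleOfLength A l

/-- A cycle factor: a spanning collection of vertex-disjoint directed cycles,
i.e. a permutation `σ` with `v → σ v` an arc for every `v` (in a loopless
digraph all orbits have length `≥ 2`). -/
def HasCycleFactor (A : V → V → Prop) : Prop :=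
  ∃ σ : Equiv.Perm V, ∀ v, A v (σ v)

/-- `arcs(S,T) = |A[S,T]| + |A[T,S]|`. -/
noncomputable def arcsCount (A : V → V → Prop) (S T : Set V) : ℕ :=
  {p : V × V | p.1 ∈ S ∧ p.2 ∈ T ∧ A p.1 p.2}.ncard +
  {p : V × V | p.1 ∈ T ∧ p.2 ∈ S ∧ A p.1 p.2}.ncard

/-- A directed path from `x` to `y`, given by its list of vertices. -/
structure IsDiPath {V : Type*} (A : V → V → Prop) (L : List V) (x y : V) : Prop where
  nodup : L.Nodup
  chain : L.IsChain A
  head : L.head? = some x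
  last : L.getLast? = some y

namespace IsDiPath

variable {V : Type*} {A : V → V → Prop} {L L' : List V} {x y x' y' : V}

theorem ne_nil (h : IsDiPath A L x y) : L ≠ [] := by
  rintro rfl
  simpa using h.head

theorem head_mem (h : IsDiPath A L x y) : x ∈ L := List.mem_of_head? h.head

theorem last_mem (h : IsDiPath A L x y) : y ∈ L := List.mem_of_getLast? h.last

theorem singleton (x : V) : IsDiPath A [x] x x := ⟨by simp, by simp, by simp, by simp⟩

theorem append (h : IsDiPath A L x y) (h' : IsDiPath A L' x' y') (hA : A y x')
    (hd : List.Disjoint L L') : IsDiPath A (L ++ L') x y' where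
  nodup := List.nodup_append'.2 ⟨h.nodup, h'.nodup, hd⟩
  chain := List.isChain_append.2 ⟨h.chain, h'.chain, by simp [h.last, h'.head, hA]⟩
  head := by simp [h.head]
  last := by simp [h'.last]

/-- A path whose ends are joined by an arc closes up to a cycle. -/
theorem hasCycleOfLength (h : IsDiPath A L x y) (hA : A y x) :
    HasCycleOfLength A L.length := by
  obtain ⟨m, hm⟩ : ∃ m, L.length = m + 1 :=
    Nat.exists_eq_succ_of_ne_zero (by simpa using h.ne_nil)
  have hx : L[0]'(by omega) = x := by
    have := h.head
    rw [List.head?_eq_getElem?, List.getElem?_eq_getElem (by omega)] at this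
    simpa using this
  have hy : L[m]'(by omega) = y := by
    have := h.last
    rw [List.getLast?_eq_getElem?, List.getElem?_eq_getElem (by omega)] at this
    simpa [hm] using this
  let g : Fin (m + 1) → V := fun i => L[i.1]'(by omega)
  have hg : ∀ i, A (g i) (g (i + 1)) := by
    intro i
    have hv := Fin.val_add_one i
    split_ifs at hv with hi
    · have e1 : g (i + 1) = x := by simp only [g, hv, hx]
      have e2 : g i = y := by simp only [g, hi, Fin.val_last, hy]
      rw [e1, e2]
      exact hA
    · have hi' : i.1 + 1 < L.length := by
        have : i.1 ≠ m := fun e => hi (Fin.ext e)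
        omega
      have e1 : g (i + 1) = L[i.1 + 1] := by simp only [g, hv]
      rw [e1]
      exact List.isChain_iff_getElem.1 h.chain _ _
  rw [hm]
  exact ⟨g, fun i j hij => Fin.ext ((h.nodup.getElem_inj_iff).1 hij), hg⟩

variable [DecidableEq V]

theorem formPerm_last (h : IsDiPath A L x y) : L.formPerm y = x := by
  have hx := h.head
  have hy := h.last
  cases L with
  | nil => simp at hx
  | cons z t =>
    obtain rfl : z = x := by simpa using hx
    have : (z :: t).getLast (by simp) = y := by
      rw [List.getLast?_eq_getLast_of_ne_nil (by simp)] at hy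
      simpa using hy
    rw [← this, List.formPerm_apply_getLast]

/-- A cycle can be cut open at any of its vertices. -/
theorem exists_isRotated (h : IsDiPath A L x y) (hA : A y x) {u : V} (hu : u ∈ L) :
    ∃ L', IsDiPath A L' (L.formPerm u) u ∧ L ~r L' := by
  obtain ⟨s, t, rfl⟩ := List.append_of_mem hu
  have hrot : (s ++ u :: t) ~r (t ++ (s ++ [u])) := by
    have : s ++ u :: t = (s ++ [u]) ++ t := by simp
    rw [this]
    exact List.isRotated_append
  have hn := (hrot.nodup_iff).1 h.nodup
  suffices hp : ∃ z, IsDiPath A (t ++ (s ++ [u])) z u by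
    obtain ⟨z, hz⟩ := hp
    refine ⟨_, ?_, hrot⟩
    rw [List.formPerm_eq_of_isRotated h.nodup hrot, hz.formPerm_last]
    exact hz
  have hc : List.IsChain A ((s ++ [u]) ++ t) := by simpa using h.chain
  rw [List.isChain_append] at hc
  have hh := h.head
  have hl := h.last
  cases t with
  | nil => exact ⟨x, hn, by simpa using h.chain, by simpa using hh, by simp⟩
  | cons w t =>
    refine ⟨w, hn, List.isChain_append.2 ⟨hc.2.1, hc.1, ?_⟩, by simp, by
      rw [← List.append_assoc, List.getLast?_concat]⟩
    have e1 : (w :: t).getLast? = some y := by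
      simpa [List.getLast?_append] using hl
    have e2 : (s ++ [u]).head? = some x := by
      cases s <;> simpa using hh
    rw [e1, e2]
    simpa using hA

theorem arc_formPerm (h : IsDiPath A L x y) (hA : A y x) {u : V} (hu : u ∈ L) :
    A u (L.formPerm u) := by
  obtain ⟨i, hi, rfl⟩ := List.getElem_of_mem hu
  by_cases hi' : i + 1 < L.length
  · rw [List.formPerm_apply_lt_getElem L h.nodup i hi']
    exact List.isChain_iff_getElem.1 h.chain _ _
  · have : L[i] = y := by
      have := h.last
      rw [List.getLast?_eq_getElem?, List.getElem?_eq_getElem (by omega)] at this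
      have e : i = L.length - 1 := by omega
      simpa [e] using this
    rw [this, h.formPerm_last]
    exact hA

/-- Cut a path after an inner vertex `u`. -/
theorem exists_split (h : IsDiPath A L x y) {u : V} (hu : u ∈ L) (huy : u ≠ y) :
    ∃ L₁ L₂, L = L₁ ++ L₂ ∧ IsDiPath A L₁ x u ∧ IsDiPath A L₂ (L.formPerm u) y := by
  obtain ⟨s, t, rfl⟩ := List.append_of_mem hu
  have e : s ++ u :: t = (s ++ [u]) ++ t := by simp
  have hl := h.last
  have hh := h.head
  cases t with
  | nil => exact absurd (by simpa using hl) huy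
  | cons w t =>
    have hw : (s ++ u :: w :: t).formPerm u = w := by
      have := List.formPerm_apply_lt_getElem _ h.nodup s.length (by simp)
      simpa using this
    have hn := h.nodup
    have hc := h.chain
    rw [e] at hn hc
    rw [List.isChain_append] at hc
    refine ⟨s ++ [u], w :: t, e, ⟨(List.nodup_append'.1 hn).1, hc.1, ?_, by simp⟩,
      ⟨(List.nodup_append'.1 hn).2.1, hc.2.1, by simp [hw], ?_⟩⟩
    · cases s <;> simpa using hh
    · simpa [List.getLast?_append] using hl

theorem drop_two (h : IsDiPath A L x y) (hlen : 3 ≤ L.length) :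
    IsDiPath A (L.drop 2) ((L.formPerm ^ 3) y) y := by
  match L, h, hlen with
  | p :: q :: r :: t, h, _ =>
    have e1 : (p :: q :: r :: t).formPerm y = p := by
      rw [h.formPerm_last]
      simpa using h.head.symm
    have e2 : (p :: q :: r :: t).formPerm p = q :=
      List.formPerm_apply_lt_getElem _ h.nodup 0 (by simp)
    have e3 : (p :: q :: r :: t).formPerm q = r :=
      List.formPerm_apply_lt_getElem _ h.nodup 1 (by simp)
    have e4 : ((p :: q :: r :: t).formPerm ^ 3) y = r := by
      simp only [pow_succ, pow_zero, one_mul, Equiv.Perm.mul_apply, e1, e2, e3]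
    rw [e4]
    have hn := h.nodup
    have hc := h.chain
    have hl := h.last
    refine ⟨?_, ?_, rfl, ?_⟩
    · simp only [List.nodup_cons] at hn
      simpa using hn.2.2
    · simp only [List.isChain_cons_cons] at hc
      exact hc.2.2
    · simpa using hl

omit [DecidableEq V] in
theorem take_succ (h : IsDiPath A L x y) (n : ℕ) (hn : n < L.length) :
    IsDiPath A (L.take (n + 1)) x L[n] where
  nodup := h.nodup.sublist (List.take_sublist _ _)
  chain := h.chain.take _
  head := by
    rw [List.head?_take]
    simp [h.head]
  last := by
    rw [List.getLast?_take]
    simp [hn]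

end IsDiPath

/-- The orbit of `v` under a permutation moving along arcs, listed so that it ends in `v`. -/
theorem exists_isDiPath_orbit {V : Type*} [Fintype V] [DecidableEq V] {A : V → V → Prop}
    (σ : Equiv.Perm V) (hσ : ∀ v, A v (σ v)) (hne : ∀ v, σ v ≠ v) (v : V) :
    ∃ L, IsDiPath A L (σ v) v ∧ ∀ w, w ∈ L ↔ σ.SameCycle v w := by
  have hmem : ∀ w, w ∈ σ.toList v ↔ σ.SameCycle v w := fun w => by
    simp [Equiv.Perm.mem_toList_iff, hne]
  have hv : v ∈ σ.toList v := (hmem v).2 (Equiv.Perm.SameCycle.refl _ _)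
  have hnil : σ.toList v ≠ [] := List.ne_nil_of_mem hv
  have hp : IsDiPath A (σ.toList v) ((σ.toList v).head hnil) ((σ.toList v).getLast hnil) := by
    refine ⟨σ.nodup_toList v, ?_, List.head?_eq_some_head hnil,
      List.getLast?_eq_getLast_of_ne_nil hnil⟩
    rw [List.isChain_iff_getElem]
    intro i hi
    rw [Equiv.Perm.getElem_toList, Equiv.Perm.getElem_toList, pow_succ', Equiv.Perm.mul_apply]
    exact hσ _
  have hform : ∀ w ∈ σ.toList v, (σ.toList v).formPerm w = σ w := fun w hw => by
    rw [Equiv.Perm.formPerm_toList, ((hmem w).1 hw).cycleOf_apply]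
  have hA : A ((σ.toList v).getLast hnil) ((σ.toList v).head hnil) := by
    rw [← hp.formPerm_last, hform _ hp.last_mem]
    exact hσ _
  obtain ⟨L', hL', hr⟩ := hp.exists_isRotated hA hv
  rw [hform v hv] at hL'
  exact ⟨L', hL', fun w => (hr.mem_iff).symm.trans (hmem w)⟩

/-- In a complete bipartite digraph with equal sides there is a Hamiltonian path between any two
vertices from different sides. -/
theorem exists_isDiPath_of_complete {V : Type*} [DecidableEq V] {A : V → V → Prop} (n : ℕ) :
    ∀ (P Q : Finset V) (z u : V), Disjoint P Q → #P = n → #Q = n → u ∈ P → z ∈ Q →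
      (∀ p ∈ P, ∀ q ∈ Q, A p q ∧ A q p) →
      ∃ L, IsDiPath A L z u ∧ L.length = 2 * n ∧ ∀ w ∈ L, w ∈ P ∪ Q := by
  induction n with
  | zero =>
    intro P Q z u _ hP _ hu
    simp_all
  | succ n ih =>
    intro P Q z u hd hP hQ hu hz hc
    rcases Nat.eq_zero_or_pos n with rfl | hn
    · refine ⟨[z] ++ [u], (IsDiPath.singleton z).append (IsDiPath.singleton u) (hc u hu z hz).2 ?_,
        by simp, ?_⟩
      · simpa using fun h : u = z => Finset.disjoint_left.1 hd hu (h ▸ hz)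
      · simp [hu, hz]
    · obtain ⟨p, hp⟩ : (P.erase u).Nonempty := by
        rw [← Finset.card_pos, Finset.card_erase_of_mem hu]; omega
      obtain ⟨q, hq⟩ : (Q.erase z).Nonempty := by
        rw [← Finset.card_pos, Finset.card_erase_of_mem hz]; omega
      rw [Finset.mem_erase] at hp hq
      obtain ⟨L, hL, hlen, hmem⟩ := ih (P.erase p) (Q.erase z) q u
        (hd.mono (Finset.erase_subset _ _) (Finset.erase_subset _ _))
        (by rw [Finset.card_erase_of_mem hp.2]; omega)
        (by rw [Finset.card_erase_of_mem hz]; omega)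
        (Finset.mem_erase.2 ⟨hp.1.symm, hu⟩) (Finset.mem_erase.2 hq)
        (fun p' hp' q' hq' => hc p' (Finset.mem_of_mem_erase hp') q' (Finset.mem_of_mem_erase hq'))
      have hzp : z ≠ p := fun h => Finset.disjoint_left.1 hd hp.2 (h ▸ hz)
      have hzP : z ∉ P := fun h => Finset.disjoint_left.1 hd h hz
      have hpQ : p ∉ Q := fun h => Finset.disjoint_left.1 hd hp.2 h
      have hzL : z ∉ L := fun h => by simpa [hzP] using hmem z h
      have hpL : p ∉ L := fun h => by simpa [hpQ] using hmem p h
      refine ⟨[z] ++ ([p] ++ L), (IsDiPath.singleton z).append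
        ((IsDiPath.singleton p).append hL (hc p hp.2 q hq.2).1 (by simpa using hpL))
        (hc p hp.2 z hz).2 (by simp [hzp, hzL]), by simp [hlen]; omega, ?_⟩
      intro w hw
      simp only [List.cons_append, List.nil_append, List.mem_cons] at hw
      rcases hw with rfl | rfl | hw
      · simp [hz]
      · simp [hp.2]
      · have := hmem w hw
        simp only [Finset.mem_union, Finset.mem_erase] at this ⊢
        tauto

open scoped Classical in
/-- The indicator of the arc relation. -/
noncomputable def arcInd {V : Type*} (A : V → V → Prop) (u v : V) : ℕ := if A u v then 1 else 0

/-- The number of arcs from `S` to `T`. -/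
noncomputable def arcNum {V : Type*} (A : V → V → Prop) (S T : Finset V) : ℕ :=
  ∑ u ∈ S, ∑ v ∈ T, arcInd A u v

theorem arcInd_le_one {V : Type*} (A : V → V → Prop) (u v : V) : arcInd A u v ≤ 1 := by
  unfold arcInd; split_ifs <;> simp

theorem arcInd_eq_zero {V : Type*} {A : V → V → Prop} {u v : V} (h : ¬ A u v) :
    arcInd A u v = 0 := by simp [arcInd, h]

theorem arcInd_eq_one {V : Type*} {A : V → V → Prop} {u v : V} (h : A u v) :
    arcInd A u v = 1 := by simp [arcInd, h]

theorem arcNum_le {V : Type*} (A : V → V → Prop) (S T : Finset V) :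
    arcNum A S T ≤ #S * #T := by
  refine (Finset.sum_le_card_nsmul S _ #T fun u _ => ?_).trans_eq (by simp)
  exact (Finset.sum_le_card_nsmul T _ 1 fun v _ => arcInd_le_one A u v).trans_eq (by simp)

theorem arcNum_comm {V : Type*} (A : V → V → Prop) (S T : Finset V) :
    arcNum A S T = ∑ v ∈ T, ∑ u ∈ S, arcInd A u v := Finset.sum_comm

theorem arc_of_arcNum_eq {V : Type*} [DecidableEq V] {A : V → V → Prop} {S T : Finset V}
    (h : arcNum A S T = #S * #T) {u v : V} (hu : u ∈ S) (hv : v ∈ T) : A u v := by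
  by_contra hA
  have h1 : arcNum A (S.erase u) T ≤ #(S.erase u) * #T := arcNum_le _ _ _
  have h2 : ∑ w ∈ T.erase v, arcInd A u w ≤ #(T.erase v) :=
    (Finset.sum_le_card_nsmul _ _ 1 fun w _ => arcInd_le_one A u w).trans_eq (by simp)
  have h3 : arcNum A S T = arcNum A (S.erase u) T + ∑ w ∈ T, arcInd A u w :=
    (Finset.sum_erase_add S (fun u => ∑ w ∈ T, arcInd A u w) hu).symm
  have h4 := Finset.sum_erase_add T (fun w => arcInd A u w) hv
  rw [arcInd_eq_zero hA] at h4
  have h5 := Finset.card_erase_add_one hu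
  have h6 := Finset.card_erase_add_one hv
  rw [← h5, add_mul] at h
  omega

/-- The degree condition away from the directed cycle, together with a bipartition `X`, `Xᶜ`. -/
structure BipDegreeCond {V : Type*} [Fintype V] [DecidableEq V] (A : V → V → Prop) (X : Finset V)
    (a k : ℕ) : Prop where
  two_le : 2 ≤ k
  two_mul_le : 2 * k ≤ a
  card_left : #X = a
  card_right : #Xᶜ = a
  bip : ∀ u v, A u v → (u ∈ X ↔ v ∉ X)
  le_deg : ∀ u, a + k ≤ deg A u
  large : ∀ u v w, u ≠ v → A u w → A v w → 2 * a - k ≤ deg A u ∨ 2 * a - k ≤ deg A v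

theorem deg_eq_sum {V : Type*} [Fintype V] (A : V → V → Prop) (u : V) :
    deg A u = ∑ v, arcInd A u v + ∑ v, arcInd A v u := by
  classical
  simp [deg, outDeg, inDeg, arcInd, Set.ncard_eq_toFinset_card']

namespace BipDegreeCond

variable {V : Type*} [Fintype V] [DecidableEq V] {A : V → V → Prop} {X : Finset V} {a k : ℕ}

theorem symm (h : BipDegreeCond A X a k) : BipDegreeCond A Xᶜ a k where
  two_le := h.two_le
  two_mul_le := h.two_mul_le
  card_left := h.card_right
  card_right := by simpa using h.card_left
  bip u v huv := by
    have := h.bip u v huv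
    simp only [Finset.mem_compl]
    tauto
  le_deg := h.le_deg
  large := h.large

theorem card_eq (h : BipDegreeCond A X a k) : Fintype.card V = 2 * a := by
  rw [← Finset.card_add_card_compl X, h.card_left, h.card_right]; ring

theorem irrefl (h : BipDegreeCond A X a k) (u : V) : ¬ A u u := fun hu => by
  have := h.bip u u hu
  tauto

theorem deg_eq (h : BipDegreeCond A X a k) {u : V} (hu : u ∈ X) :
    deg A u = ∑ v ∈ Xᶜ, arcInd A u v + ∑ v ∈ Xᶜ, arcInd A v u := by
  rw [deg_eq_sum]
  congr 1 <;> symm <;> apply Finset.sum_subset (Finset.subset_univ _) <;> intro v _ hv <;>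
    apply arcInd_eq_zero <;> intro hA
  · have := h.bip _ _ hA
    simp_all
  · have := h.bip _ _ hA
    simp_all

/-- Hall's condition for subsets of one side. -/
theorem hall_side (h : BipDegreeCond A X a k) (S T : Finset V) (hS : S ⊆ X) (hT : T ⊆ Xᶜ)
    (hST : ∀ u ∈ S, ∀ v, A u v → v ∈ T) : #S ≤ #T := by
  by_contra! hlt
  have hSa : #S ≤ a := h.card_left ▸ Finset.card_le_card hS
  have h2 := h.two_le
  have h2k := h.two_mul_le
  obtain ⟨y, hy, hyT⟩ : ∃ y ∈ Xᶜ, y ∉ T := by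
    by_contra! hc
    have := Finset.card_le_card (show Xᶜ ⊆ T from hc)
    rw [h.card_right] at this
    omega
  have hyk : #S + k ≤ a := by
    have hd := h.le_deg y
    rw [h.symm.deg_eq hy, compl_compl] at hd
    have h1 : ∑ v ∈ X, arcInd A y v ≤ a :=
      (Finset.sum_le_card_nsmul X _ 1 fun w _ => arcInd_le_one A _ w).trans_eq
        (by simp [h.card_left])
    have h3 : ∑ v ∈ X, arcInd A v y = ∑ v ∈ X \ S, arcInd A v y := by
      symm
      apply Finset.sum_subset Finset.sdiff_subset
      intro v hv hv'
      have hvS : v ∈ S := by simp_all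
      exact arcInd_eq_zero fun hA => hyT (hST v hvS y hA)
    have h4 : ∑ v ∈ X \ S, arcInd A v y ≤ #(X \ S) :=
      (Finset.sum_le_card_nsmul _ _ 1 fun w _ => arcInd_le_one A w _).trans_eq (by simp)
    rw [Finset.card_sdiff_of_subset hS, h.card_left] at h4
    omega
  have hout : ∀ u ∈ S, ∑ v ∈ Xᶜ, arcInd A u v ≤ #T ∧ ∑ v ∈ Xᶜ, arcInd A v u ≤ a := by
    intro u hu
    constructor
    · have h3 : ∑ v ∈ Xᶜ, arcInd A u v = ∑ v ∈ T, arcInd A u v := by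
        symm
        apply Finset.sum_subset hT
        intro v hv hv'
        exact arcInd_eq_zero fun hA => hv' (hST u hu v hA)
      rw [h3]
      exact (Finset.sum_le_card_nsmul _ _ 1 fun w _ => arcInd_le_one A _ w).trans_eq (by simp)
    · exact (Finset.sum_le_card_nsmul _ _ 1 fun w _ => arcInd_le_one A w _).trans_eq
        (by simp [h.card_right])
  have hsmall : ∀ u ∈ S, deg A u < 2 * a - k := by
    intro u hu
    rw [h.deg_eq (hS hu)]
    have := hout u hu
    omega
  have hex : ∀ u ∈ S, ∃ w, A u w := by
    intro u hu
    by_contra! hc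
    have hd := h.le_deg u
    rw [h.deg_eq (hS hu), Finset.sum_eq_zero fun v _ => arcInd_eq_zero (hc v)] at hd
    have := hout u hu
    omega
  choose! f hf using hex
  refine hlt.not_ge (Finset.card_le_card_of_injOn f (fun u hu => hST u hu _ (hf u hu)) ?_)
  intro u hu v hv huv
  by_contra hne
  have h5 := hsmall u hu
  have h6 := hsmall v hv
  have h7 := h.large u v (f u) hne (hf u hu) (huv ▸ hf v hv)
  omega

theorem exists_cycleFactor (h : BipDegreeCond A X a k) :
    ∃ σ : Equiv.Perm V, ∀ v, A v (σ v) := by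
  classical
  obtain ⟨f, hf, hA⟩ := (Fintype.all_card_le_filter_rel_iff_exists_injective A).1 (by
    intro S
    have hX := h.hall_side (S ∩ X) ({v | ∃ u ∈ S ∩ X, A u v} : Finset V)
      Finset.inter_subset_right
      (fun v hv => by
        obtain ⟨u, hu, hA⟩ := (Finset.mem_filter.1 hv).2
        have := h.bip u v hA
        simp_all)
      (fun u hu v hA => by
        simp only [Finset.mem_filter, Finset.mem_univ, true_and]
        exact ⟨u, hu, hA⟩)
    have hY := h.symm.hall_side (S ∩ Xᶜ) ({v | ∃ u ∈ S ∩ Xᶜ, A u v} : Finset V)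
      Finset.inter_subset_right
      (fun v hv => by
        obtain ⟨u, hu, hA⟩ := (Finset.mem_filter.1 hv).2
        have := h.bip u v hA
        simp_all)
      (fun u hu v hA => by
        simp only [Finset.mem_filter, Finset.mem_univ, true_and]
        exact ⟨u, hu, hA⟩)
    have hS : #S = #(S ∩ X) + #(S ∩ Xᶜ) := by
      rw [← Finset.card_inter_add_card_sdiff S X, Finset.sdiff_eq_inter_compl]
    rw [hS]
    refine (add_le_add hX hY).trans ?_
    rw [← Finset.card_union_of_disjoint]
    · apply Finset.card_le_card
      intro v hv
      simp only [Finset.mem_union, Finset.mem_filter, Finset.mem_univ, true_and,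
        Finset.mem_inter] at hv ⊢
      rcases hv with ⟨u, hu, hA⟩ | ⟨u, hu, hA⟩ <;> exact ⟨u, hu.1, hA⟩
    · rw [Finset.disjoint_left]
      intro v hv hv'
      obtain ⟨u, hu, hA⟩ := (Finset.mem_filter.1 hv).2
      obtain ⟨u', hu', hA'⟩ := (Finset.mem_filter.1 hv').2
      have := h.bip u v hA
      have := h.bip u' v hA'
      simp_all)
  exact ⟨Equiv.ofBijective f (Finite.injective_iff_bijective.1 hf), hA⟩

end BipDegreeCond

namespace BipDegreeCond

variable {V : Type*} [Fintype V] [DecidableEq V] {A : V → V → Prop} {X : Finset V} {a k : ℕ}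

theorem sum_inter_add_sum_inter_compl (S T : Finset V) (f : V → ℕ) :
    ∑ v ∈ T ∩ S, f v + ∑ v ∈ T ∩ Sᶜ, f v = ∑ v ∈ T, f v := by
  rw [← Finset.sdiff_eq_inter_compl, Finset.sum_inter_add_sum_sdiff]

theorem sum_deg (h : BipDegreeCond A X a k) (S : Finset V) :
    ∑ u ∈ X ∩ S, deg A u = arcNum A (X ∩ S) (Xᶜ ∩ S) + arcNum A (X ∩ S) (Xᶜ ∩ Sᶜ) +
      (arcNum A (Xᶜ ∩ S) (X ∩ S) + arcNum A (Xᶜ ∩ Sᶜ) (X ∩ S)) := by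
  rw [arcNum_comm A (Xᶜ ∩ S), arcNum_comm A (Xᶜ ∩ Sᶜ)]
  simp only [arcNum]
  rw [← Finset.sum_add_distrib, ← Finset.sum_add_distrib, ← Finset.sum_add_distrib]
  refine Finset.sum_congr rfl fun u hu => ?_
  rw [h.deg_eq (Finset.mem_inter.1 hu).1, sum_inter_add_sum_inter_compl,
    sum_inter_add_sum_inter_compl]

/-- The vertices of `S` of degree less than `2 * a - k`. -/
noncomputable def small (A : V → V → Prop) (a k : ℕ) (S : Finset V) : Finset V :=
  {u ∈ S | deg A u < 2 * a - k}

theorem arcNum_add_small_le (h : BipDegreeCond A X a k) (S T : Finset V) :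
    arcNum A S T + #T * #(small A a k S) ≤ #T * (#S + 1) := by
  have key : ∀ v ∈ T, ∑ u ∈ S, arcInd A u v + #(small A a k S) ≤ #S + 1 := by
    intro v _
    have h1 : ∑ u ∈ small A a k S, arcInd A u v ≤ 1 := by
      by_cases hex : ∃ u ∈ small A a k S, A u v
      · obtain ⟨u, hu, hA⟩ := hex
        rw [Finset.sum_eq_single_of_mem u hu]
        · exact arcInd_le_one _ _ _
        · intro w hw hwu
          refine arcInd_eq_zero fun hA' => ?_
          have h3 := (Finset.mem_filter.1 hu).2
          have h4 := (Finset.mem_filter.1 hw).2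
          have h5 := h.large w u v hwu hA' hA
          omega
      · push Not at hex
        rw [Finset.sum_eq_zero fun u hu => arcInd_eq_zero (hex u hu)]
        exact zero_le_one
    have h2 : ∑ u ∈ S \ small A a k S, arcInd A u v ≤ #(S \ small A a k S) :=
      (Finset.sum_le_card_nsmul _ _ 1 fun w _ => arcInd_le_one A w _).trans_eq (by simp)
    have h3 : ∑ u ∈ S \ small A a k S, arcInd A u v + ∑ u ∈ small A a k S, arcInd A u v =
        ∑ u ∈ S, arcInd A u v := Finset.sum_sdiff (Finset.filter_subset (deg A · < 2 * a - k) S)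
    have h4 : #(S \ small A a k S) + #(small A a k S) = #S :=
      Finset.card_sdiff_add_card_eq_card (Finset.filter_subset (deg A · < 2 * a - k) S)
    omega
  have := Finset.sum_le_sum key
  rw [Finset.sum_add_distrib, ← arcNum_comm] at this
  simpa using this

theorem le_sum_deg_add_small (h : BipDegreeCond A X a k) (S : Finset V) :
    #S * (2 * a - k) ≤ ∑ u ∈ S, deg A u + #(small A a k S) * (a - 2 * k) := by
  have h2k := h.two_mul_le
  rw [small, Finset.card_filter, Finset.sum_mul, ← Finset.sum_add_distrib, ← smul_eq_mul]
  refine Finset.card_nsmul_le_sum _ _ _ fun u _ => ?_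
  have := h.le_deg u
  split_ifs <;> omega

theorem le_sum_deg (h : BipDegreeCond A X a k) (S : Finset V) :
    #S * (a + k) ≤ ∑ u ∈ S, deg A u := by
  rw [← smul_eq_mul]
  exact Finset.card_nsmul_le_sum _ _ _ fun u _ => h.le_deg u

theorem card_inter_eq {φ : Equiv.Perm V} {S : Finset V} (hS : ∀ v, φ v ∈ S ↔ v ∈ S)
    (hX : ∀ v, φ v ∈ X ↔ v ∉ X) : #(X ∩ S) = #(Xᶜ ∩ S) := by
  refine Finset.card_equiv φ fun v => ?_
  simp [hS, hX]

theorem cross_le {φ : Equiv.Perm V} {S : Finset V} (hS : ∀ v, φ v ∈ S ↔ v ∈ S)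
    (hX : ∀ v, φ v ∈ X ↔ v ∉ X) (hno : ∀ u ∈ S, ∀ v ∉ S, A u (φ v) → ¬ A v (φ u)) :
    arcNum A (X ∩ S) (Xᶜ ∩ Sᶜ) + arcNum A (X ∩ Sᶜ) (Xᶜ ∩ S) ≤ #(X ∩ S) * #(X ∩ Sᶜ) := by
  have h1 : arcNum A (X ∩ S) (Xᶜ ∩ Sᶜ) = ∑ u ∈ X ∩ S, ∑ v ∈ X ∩ Sᶜ, arcInd A u (φ v) := by
    refine Finset.sum_congr rfl fun u _ => (Finset.sum_equiv φ ?_ ?_).symm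
    · simp [hS, hX]
    · simp
  have h2 : arcNum A (X ∩ Sᶜ) (Xᶜ ∩ S) = ∑ u ∈ X ∩ S, ∑ v ∈ X ∩ Sᶜ, arcInd A v (φ u) := by
    rw [arcNum_comm]
    refine (Finset.sum_equiv φ ?_ ?_).symm
    · simp [hS, hX]
    · simp
  rw [h1, h2, ← Finset.sum_add_distrib, ← smul_eq_mul]
  refine Finset.sum_le_card_nsmul _ _ _ fun u hu => ?_
  rw [← Finset.sum_add_distrib]
  refine (Finset.sum_le_card_nsmul _ _ 1 fun v hv => ?_).trans_eq (by simp)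
  have := hno u (Finset.mem_inter.1 hu).2 v (Finset.mem_compl.1 (Finset.mem_inter.1 hv).2)
  have h3 := arcInd_le_one A u (φ v)
  have h4 := arcInd_le_one A v (φ u)
  by_cases hA : A u (φ v)
  · rw [arcInd_eq_zero (this hA)]
    omega
  · rw [arcInd_eq_zero hA]
    omega

/-- If no exchange along `φ` joins `S` to its complement, then `S` contains at least half of the
vertices, and in case of equality `S` induces a complete bipartite digraph. -/
theorem half_le_card (h : BipDegreeCond A X a k) {φ : Equiv.Perm V} {S : Finset V}
    (hS : ∀ v, φ v ∈ S ↔ v ∈ S) (hX : ∀ v, φ v ∈ X ↔ v ∉ X)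
    (hno : ∀ u ∈ S, ∀ v ∉ S, A u (φ v) → ¬ A v (φ u)) (hpos : 0 < #(X ∩ S)) :
    a ≤ 2 * #(X ∩ S) ∧ (a = 2 * #(X ∩ S) →
      ∀ u ∈ X ∩ S, ∀ v ∈ Xᶜ ∩ S, A u v ∧ A v u) := by
  have hX' : ∀ v, φ v ∈ Xᶜ ↔ v ∉ Xᶜ := fun v => by simp [hX]
  have hm : #(Xᶜ ∩ S) = #(X ∩ S) := (card_inter_eq hS hX).symm
  have hn : #(Xᶜ ∩ Sᶜ) = #(X ∩ Sᶜ) :=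
    (card_inter_eq (fun v => by simp [hS]) hX).symm
  have hmn : #(X ∩ S) + #(X ∩ Sᶜ) = a := by
    rw [← Finset.sdiff_eq_inter_compl, Finset.card_inter_add_card_sdiff, h.card_left]
  have c1 := cross_le hS hX hno
  have c2 := cross_le hS hX' hno
  have d1 := h.sum_deg S
  have d2 := h.symm.sum_deg S
  have l1 := h.le_sum_deg_add_small (X ∩ S)
  have l2 := h.le_sum_deg_add_small (Xᶜ ∩ S)
  have b1 := h.le_sum_deg (X ∩ S)
  have b2 := h.le_sum_deg (Xᶜ ∩ S)
  have s1 := h.arcNum_add_small_le (X ∩ S) (Xᶜ ∩ S)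
  have s2 := h.arcNum_add_small_le (Xᶜ ∩ S) (X ∩ S)
  have e1 := arcNum_le A (X ∩ S) (Xᶜ ∩ S)
  have e2 := arcNum_le A (Xᶜ ∩ S) (X ∩ S)
  have hfull : a = 2 * #(X ∩ S) →
      2 * (#(X ∩ S) * #(X ∩ S)) ≤ arcNum A (X ∩ S) (Xᶜ ∩ S) + arcNum A (Xᶜ ∩ S) (X ∩ S) →
      ∀ u ∈ X ∩ S, ∀ v ∈ Xᶜ ∩ S, A u v ∧ A v u := by
    intro _ hle u hu v hv
    rw [hm] at e1 e2
    refine ⟨arc_of_arcNum_eq ?_ hu hv, arc_of_arcNum_eq ?_ hv hu⟩ <;> rw [hm] <;> omega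
  simp only [compl_compl, hm, hn] at c1 c2 d1 d2 l1 l2 b1 b2 s1 s2 e1 e2
  have h2 := h.two_le
  have h2k := h.two_mul_le
  rw [d1] at l1 b1
  rw [d2] at l2 b2
  generalize #(X ∩ S) = m at *
  generalize #(X ∩ Sᶜ) = n at *
  generalize arcNum A (X ∩ S) (Xᶜ ∩ S) = i1 at *
  generalize arcNum A (Xᶜ ∩ S) (X ∩ S) = i2 at *
  generalize #(small A a k (X ∩ S)) = t1 at *
  generalize #(small A a k (Xᶜ ∩ S)) = t2 at *
  obtain ⟨b, rfl⟩ := Nat.exists_eq_add_of_le h2k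
  have r1 : 2 * (2 * k + b) - k = 3 * k + 2 * b := by omega
  have r2 : 2 * k + b - 2 * k = b := by omega
  rw [r1, r2] at l1 l2
  have main : 3 * (2 * k + b) * m ≤ 2 * (i1 + i2) + 2 * (m * n) := by
    rcases le_or_gt (t1 + t2) m with ht | ht
    · have : (t1 + t2) * b ≤ m * b := Nat.mul_le_mul_right _ ht
      nlinarith
    · exfalso
      have : m * (m + 1) ≤ m * (t1 + t2) := Nat.mul_le_mul_left _ ht
      have h3 : m * (2 * k + b) = m * (m + n) := by rw [hmn]
      have h4 : m * 2 ≤ m * k := Nat.mul_le_mul_left _ h2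
      nlinarith
  have h3 : m * (2 * k + b) = m * (m + n) := by rw [hmn]
  refine ⟨?_, fun ha => hfull ha ?_⟩
  · have : m * (2 * k + b) ≤ m * (2 * m) := by nlinarith
    exact Nat.le_of_mul_le_mul_left this hpos
  · obtain rfl : n = m := by omega
    rw [ha] at main
    linarith

end BipDegreeCond

/-- The digraph has a directed cycle on `n` vertices, given by a list of vertices. -/
def HasListCycle {V : Type*} (A : V → V → Prop) (n : ℕ) : Prop :=
  ∃ L x y, IsDiPath A L x y ∧ A y x ∧ L.length = n

theorem HasListCycle.hasCycleOfLength {V : Type*} {A : V → V → Prop} {n : ℕ}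
    (h : HasListCycle A n) : HasCycleOfLength A n := by
  obtain ⟨L, x, y, hL, hA, rfl⟩ := h
  exact hL.hasCycleOfLength hA

/-- Two disjoint complete bipartite digraphs joined by arcs in both directions. -/
theorem hasListCycle_of_two_complete {V : Type*} [DecidableEq V] {A : V → V → Prop}
    {P Q P' Q' : Finset V} {m : ℕ} (hPQ : Disjoint P Q) (hPQ' : Disjoint P' Q')
    (hd : Disjoint (P ∪ Q) (P' ∪ Q')) (hm : 2 ≤ m) (hP : #P = m) (hQ : #Q = m) (hP' : #P' = m)
    (hQ' : #Q' = m) (hc : ∀ p ∈ P, ∀ q ∈ Q, A p q ∧ A q p)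
    (hc' : ∀ p ∈ P', ∀ q ∈ Q', A p q ∧ A q p) {u v w z : V} (hu : u ∈ P) (hw : w ∈ Q')
    (hv : v ∈ P') (hz : z ∈ Q) (huw : A u w) (hvz : A v z) :
    HasListCycle A (2 * (2 * m)) ∧ HasListCycle A (2 * (2 * m - 1)) := by
  obtain ⟨L', hL', hlen', hmem'⟩ := exists_isDiPath_of_complete m P' Q' w v hPQ' hP' hQ' hv hw hc'
  have key : ∀ n (P₀ Q₀ : Finset V), P₀ ⊆ P → Q₀ ⊆ Q → #P₀ = n → #Q₀ = n → u ∈ P₀ → z ∈ Q₀ →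
      HasListCycle A (2 * n + 2 * m) := by
    intro n P₀ Q₀ hP₀ hQ₀ h1 h2 hu hz
    obtain ⟨L, hL, hlen, hmem⟩ := exists_isDiPath_of_complete n P₀ Q₀ z u (hPQ.mono hP₀ hQ₀)
      h1 h2 hu hz (fun p hp q hq => hc p (hP₀ hp) q (hQ₀ hq))
    refine ⟨L ++ L', z, v, hL.append hL' huw ?_, hvz, by simp [hlen, hlen']⟩
    intro x hx hx'
    exact Finset.disjoint_left.1 hd (Finset.union_subset_union hP₀ hQ₀ (hmem x hx)) (hmem' x hx')
  constructor
  · have := key m P Q subset_rfl subset_rfl hP hQ hu hz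
    rwa [show 2 * m + 2 * m = 2 * (2 * m) by ring] at this
  · obtain ⟨p, hp⟩ : (P.erase u).Nonempty := by
      rw [← Finset.card_pos, Finset.card_erase_of_mem hu]; omega
    obtain ⟨q, hq⟩ : (Q.erase z).Nonempty := by
      rw [← Finset.card_pos, Finset.card_erase_of_mem hz]; omega
    rw [Finset.mem_erase] at hp hq
    have := key (m - 1) (P.erase p) (Q.erase q) (Finset.erase_subset _ _) (Finset.erase_subset _ _)
      (by rw [Finset.card_erase_of_mem hp.2, hP]) (by rw [Finset.card_erase_of_mem hq.2, hQ])
      (Finset.mem_erase.2 ⟨hp.1.symm, hu⟩) (Finset.mem_erase.2 ⟨hq.1.symm, hz⟩)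
    rwa [show 2 * (m - 1) + 2 * m = 2 * (2 * m - 1) by omega] at this

theorem StronglyConnected.exists_arc {V : Type*} {A : V → V → Prop} (hsc : StronglyConnected A)
    {p : V → Prop} {s t : V} (hs : p s) (ht : ¬ p t) : ∃ u v, p u ∧ ¬ p v ∧ A u v := by
  by_contra! hc
  have key : ∀ v, Relation.ReflTransGen A s v → p v := fun v hv => by
    induction hv with
    | refl => exact hs
    | tail _ hA ih => exact by_contra fun hp => hc _ _ ih hp hA
  exact ht (key t (hsc s t))

namespace BipDegreeCond

variable {V : Type*} [Fintype V] [DecidableEq V] {A : V → V → Prop} {X : Finset V} {a k : ℕ}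

/-- If no exchange along `φ` joins `S` to its complement, then the digraph consists of two complete
bipartite halves, and long cycles exist. -/
theorem hasListCycle_of_no_exchange (h : BipDegreeCond A X a k) (hsc : StronglyConnected A)
    {φ : Equiv.Perm V} {S : Finset V}
    (hS : ∀ v, φ v ∈ S ↔ v ∈ S) (hX : ∀ v, φ v ∈ X ↔ v ∉ X)
    (hno : ∀ u ∈ S, ∀ v ∉ S, A u (φ v) → ¬ A v (φ u)) {s t : V} (hs : s ∈ S) (ht : t ∉ S) :
    HasListCycle A (2 * a) ∧ HasListCycle A (2 * (a - 1)) := by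
  have hS' : ∀ v, φ v ∈ Sᶜ ↔ v ∈ Sᶜ := fun v => by simp [hS]
  have hno' : ∀ u ∈ Sᶜ, ∀ v ∉ Sᶜ, A u (φ v) → ¬ A v (φ u) := fun u hu v hv h1 h2 =>
    hno v (by simpa using hv) u (by simpa using hu) h2 h1
  have hpos : ∀ T : Finset V, (∀ v, φ v ∈ T ↔ v ∈ T) → ∀ r ∈ T, 0 < #(X ∩ T) := by
    intro T hT r hr
    rw [Finset.card_pos]
    by_cases hrX : r ∈ X
    · exact ⟨r, Finset.mem_inter.2 ⟨hrX, hr⟩⟩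
    · exact ⟨φ r, Finset.mem_inter.2 ⟨(hX r).2 hrX, (hT r).2 hr⟩⟩
  obtain ⟨l1, f1⟩ := h.half_le_card hS hX hno (hpos S hS s hs)
  obtain ⟨l2, f2⟩ := h.half_le_card hS' hX hno' (hpos Sᶜ hS' t (by simpa using ht))
  have hmn : #(X ∩ S) + #(X ∩ Sᶜ) = a := by
    rw [← Finset.sdiff_eq_inter_compl, Finset.card_inter_add_card_sdiff, h.card_left]
  have hm : a = 2 * #(X ∩ S) := by omega
  have hn : a = 2 * #(X ∩ Sᶜ) := by omega
  have g1 := card_inter_eq hS hX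
  have g2 := card_inter_eq hS' hX
  specialize f1 hm
  specialize f2 hn
  have h2 := h.two_le
  have h2k := h.two_mul_le
  have hcompl : ∀ T : Finset V, Disjoint (X ∩ T) (Xᶜ ∩ T) := fun T =>
    Disjoint.mono Finset.inter_subset_left Finset.inter_subset_left disjoint_compl_right
  have hd : Disjoint (X ∩ S ∪ Xᶜ ∩ S) (X ∩ Sᶜ ∪ Xᶜ ∩ Sᶜ) :=
    Disjoint.mono (Finset.union_subset Finset.inter_subset_right Finset.inter_subset_right)
      (Finset.union_subset Finset.inter_subset_right Finset.inter_subset_right)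
      disjoint_compl_right
  have join : ∀ u w v z, u ∈ S → w ∉ S → v ∉ S → z ∈ S → A u w → A v z → (u ∈ X ↔ v ∈ X) →
      HasListCycle A (2 * a) ∧ HasListCycle A (2 * (a - 1)) := by
    intro u w v z hu hw hv hz huw hvz huv
    have b1 := h.bip u w huw
    have b2 := h.bip v z hvz
    have e : a = 2 * #(X ∩ S) := hm
    by_cases huX : u ∈ X
    · have mu : u ∈ X ∩ S := Finset.mem_inter.2 ⟨huX, hu⟩
      have mw : w ∈ Xᶜ ∩ Sᶜ := by simp [hw, b1.1 huX]
      have mv : v ∈ X ∩ Sᶜ := by simp [hv, huv.1 huX]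
      have mz : z ∈ Xᶜ ∩ S := by simp [hz, b2.1 (huv.1 huX)]
      have := hasListCycle_of_two_complete (hcompl S) (hcompl Sᶜ) hd (by omega) rfl g1.symm
        (by omega) (by omega) f1 f2 mu mw mv mz huw hvz
      rwa [← e] at this
    · have hvX : v ∉ X := fun hv => huX (huv.2 hv)
      have mu : u ∈ Xᶜ ∩ S := by simp [hu, huX]
      have mw : w ∈ X ∩ Sᶜ := by simp [hw, not_not.1 (mt b1.2 huX)]
      have mv : v ∈ Xᶜ ∩ Sᶜ := by simp [hv, hvX]
      have mz : z ∈ X ∩ S := by simp [hz, not_not.1 (mt b2.2 hvX)]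
      have := hasListCycle_of_two_complete (hcompl S).symm (hcompl Sᶜ).symm
        (by rwa [Finset.union_comm, Finset.union_comm (Xᶜ ∩ Sᶜ)]) (m := #(X ∩ S)) (by omega)
        g1.symm rfl (by omega) (by omega) (fun p hp q hq => (f1 q hq p hp).symm)
        (fun p hp q hq => (f2 q hq p hp).symm) mu mw mv mz huw hvz
      rwa [← e] at this
  obtain ⟨u, w, hu, hw, huw⟩ := hsc.exists_arc (p := (· ∈ S)) hs ht
  obtain ⟨v, z, hv, hz, hvz⟩ := hsc.exists_arc (p := (· ∉ S)) ht (by simpa using hs)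
  rw [not_not] at hz
  by_cases huv : u ∈ X ↔ v ∈ X
  · exact join u w v z hu hw hv hz huw hvz huv
  -- the neighbour `y` of `u` sends or receives an arc across
  obtain ⟨y, hy, hyX⟩ : ∃ y ∈ S, (y ∈ X ↔ u ∉ X) := ⟨φ u, (hS u).2 hu, hX u⟩
  obtain ⟨x, hx, hA⟩ : ∃ x, x ∉ S ∧ (A y x ∨ A x y) := by
    by_contra! hc
    have hdeg := h.le_deg y
    have bound : ∀ f : V → ℕ, (∀ v, f v ≤ 1) → (∀ v, v ∉ S → f v = 0) →
        (∀ v, (v ∈ X ↔ y ∈ X) → f v = 0) → ∑ v, f v ≤ #(X ∩ S) := by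
      intro f hf hf1 hf2
      have : ∀ T : Finset V, #T = #(X ∩ S) → (∀ v, v ∉ T → f v = 0) → ∑ v, f v ≤ #(X ∩ S) := by
        intro T hT hT'
        rw [← Finset.sum_subset (Finset.subset_univ T) fun v _ hv => hT' v hv, ← hT]
        exact (Finset.sum_le_card_nsmul _ _ 1 fun v _ => hf v).trans_eq (by simp)
      by_cases hyX' : y ∈ X
      · refine this (Xᶜ ∩ S) g1.symm fun v hv => ?_
        by_cases hvS : v ∈ S
        · exact hf2 v (by simp [hvS] at hv; simp [hv, hyX'])
        · exact hf1 v hvS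
      · refine this (X ∩ S) rfl fun v hv => ?_
        by_cases hvS : v ∈ S
        · exact hf2 v (by simp [hvS] at hv; simp [hv, hyX'])
        · exact hf1 v hvS
    rw [deg_eq_sum] at hdeg
    have k1 := bound (fun v => arcInd A y v) (fun v => arcInd_le_one _ _ _)
      (fun v hv => arcInd_eq_zero (hc v hv).1)
      (fun v hv => arcInd_eq_zero fun hA => by have := h.bip _ _ hA; tauto)
    have k2 := bound (fun v => arcInd A v y) (fun v => arcInd_le_one _ _ _)
      (fun v hv => arcInd_eq_zero (hc v hv).2)
      (fun v hv => arcInd_eq_zero fun hA => by have := h.bip _ _ hA; tauto)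
    omega
  rcases hA with hA | hA
  · exact join y x v z hy hx hv hz hA hvz (by tauto)
  · exact join u w x y hu hw hx hy huw hA (by have := h.bip _ _ hA; tauto)

end BipDegreeCond

namespace BipDegreeCond

variable {V : Type*} [Fintype V] [DecidableEq V] {A : V → V → Prop} {X : Finset V} {a k : ℕ}

theorem hasListCycle_two_mul (h : BipDegreeCond A X a k) (hsc : StronglyConnected A) :
    HasListCycle A (2 * a) := by
  by_contra hnot
  obtain ⟨σ, hσ⟩ := h.exists_cycleFactor
  have hne : ∀ v, σ v ≠ v := fun v hv => h.irrefl v (by simpa [hv] using hσ v)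
  have ha : 0 < a := by
    have := h.two_le
    have := h.two_mul_le
    omega
  have hpow : ∀ (L : List V), (∀ v, σ v ∈ L ↔ v ∈ L) → ∀ (n : ℕ) v, (σ ^ n) v ∈ L ↔ v ∈ L := by
    intro L hL n
    induction n with
    | zero => simp
    | succ n ih =>
      intro v
      rw [pow_succ', Equiv.Perm.mul_apply, hL, ih]
  have key : ∀ n, ∃ L x y, IsDiPath A L x y ∧ A y x ∧ (∀ v, σ v ∈ L ↔ v ∈ L) ∧ n ≤ L.length := by
    intro n
    induction n with
    | zero =>
      obtain ⟨v, -⟩ : X.Nonempty := by rw [← Finset.card_pos, h.card_left]; exact ha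
      obtain ⟨L, hL, hmem⟩ := exists_isDiPath_orbit σ hσ hne v
      exact ⟨L, σ v, v, hL, hσ v, fun w => by simp [hmem], Nat.zero_le _⟩
    | succ n ih =>
      obtain ⟨L, x, y, hL, hA, hinv, hlen⟩ := ih
      obtain ⟨t, ht⟩ : ∃ t, t ∉ L := by
        by_contra! hall
        refine hnot ⟨L, x, y, hL, hA, ?_⟩
        rw [← h.card_eq, ← List.toFinset_card_of_nodup hL.nodup, ← Finset.card_univ]
        congr 1
        ext v
        simp [hall]
      let f : V → V := fun v => if v ∈ L then L.formPerm v else σ v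
      have f1 : ∀ v ∈ L, f v = L.formPerm v := fun v hv => if_pos hv
      have f2 : ∀ v ∉ L, f v = σ v := fun v hv => if_neg hv
      have fmem : ∀ v, f v ∈ L ↔ v ∈ L := by
        intro v
        by_cases hv : v ∈ L
        · simp [f1 v hv, hv, List.formPerm_apply_mem_of_mem hv]
        · simp [f2 v hv, hv, hinv]
      have farc : ∀ v, A v (f v) := by
        intro v
        by_cases hv : v ∈ L
        · rw [f1 v hv]
          exact hL.arc_formPerm hA hv
        · rw [f2 v hv]
          exact hσ v
      have finj : Function.Injective f := by
        intro v w hvw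
        by_cases hv : v ∈ L
        · have hw : w ∈ L := by rwa [← fmem, ← hvw, fmem]
          rw [f1 v hv, f1 w hw] at hvw
          exact L.formPerm.injective hvw
        · have hw : w ∉ L := by rwa [← fmem, ← hvw, fmem]
          rw [f2 v hv, f2 w hw] at hvw
          exact σ.injective hvw
      have hex : ∃ u ∈ L, ∃ v ∉ L, A u (f v) ∧ A v (f u) := by
        by_contra! hno
        refine hnot (h.hasListCycle_of_no_exchange hsc
          (φ := Equiv.ofBijective f (Finite.injective_iff_bijective.1 finj)) (S := L.toFinset)
          (s := x) (t := t) (by simpa using fmem) ?_ (by simpa using hno)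
          (by simpa using hL.head_mem) (by simpa using ht)).1
        intro v
        have := h.bip _ _ (farc v)
        simp only [Equiv.ofBijective_apply]
        tauto
      obtain ⟨u, hu, v, hv, huv, hvu⟩ := hex
      rw [f2 v hv] at huv
      rw [f1 u hu] at hvu
      obtain ⟨L₁, hL₁, hrot⟩ := hL.exists_isRotated hA hu
      obtain ⟨L₂, hL₂, hmem⟩ := exists_isDiPath_orbit σ hσ hne v
      refine ⟨L₁ ++ L₂, _, _, hL₁.append hL₂ huv ?_, hvu, ?_, ?_⟩
      · intro w hw hw'
        obtain ⟨i, rfl⟩ := ((hmem w).1 hw').exists_nat_pow_eq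
        exact hv ((hpow L hinv i v).1 ((hrot.mem_iff).2 hw))
      · intro w
        simp [hmem, ← hrot.mem_iff, hinv]
      · have := hrot.perm.length_eq
        have := List.length_pos_of_ne_nil hL₂.ne_nil
        simp only [List.length_append]
        omega
  obtain ⟨L, x, y, hL, -, -, hlen⟩ := key (Fintype.card V + 1)
  have := hL.nodup.length_le_card
  omega

/-- A permutation moving along arcs admits an exchange at two distinct vertices. -/
theorem exists_exchange (h : BipDegreeCond A X a k) (τ : Equiv.Perm V) (hτ : ∀ v, A v (τ v)) :
    ∃ u v, u ≠ v ∧ A u (τ v) ∧ A v (τ u) := by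
  by_contra! hno
  have h2 := h.two_le
  have h2k := h.two_mul_le
  have hX : ∀ v, τ v ∈ X ↔ v ∉ X := fun v => by
    have := h.bip _ _ (hτ v)
    tauto
  have key : ∀ u, ∑ v, (arcInd A u (τ v) + arcInd A v (τ u)) ≤ a + 1 := by
    intro u
    have aux : ∀ T : Finset V, #T = a → u ∈ T → (∀ v ∉ T, (v ∈ X ↔ u ∉ X)) →
        ∑ v, (arcInd A u (τ v) + arcInd A v (τ u)) ≤ a + 1 := by
      intro T hT huT hside
      rw [← Finset.sum_subset (Finset.subset_univ T) fun v _ hv => ?_]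
      · rw [← Finset.sum_erase_add _ _ huT, arcInd_eq_one (hτ u)]
        have : ∑ v ∈ T.erase u, (arcInd A u (τ v) + arcInd A v (τ u)) ≤ #(T.erase u) := by
          refine (Finset.sum_le_card_nsmul _ _ 1 fun v hv => ?_).trans_eq (by simp)
          have h3 := arcInd_le_one A u (τ v)
          have h4 := arcInd_le_one A v (τ u)
          by_cases hA : A u (τ v)
          · rw [arcInd_eq_zero (hno u v (Finset.ne_of_mem_erase hv).symm hA)]
            omega
          · rw [arcInd_eq_zero hA]
            omega
        rw [Finset.card_erase_of_mem huT, hT] at this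
        omega
      · have h3 := hside v hv
        have h4 : ¬ A u (τ v) := fun hA => by
          have := h.bip _ _ hA
          rw [hX] at this
          tauto
        have h5 : ¬ A v (τ u) := fun hA => by
          have := h.bip _ _ hA
          rw [hX] at this
          tauto
        simp [arcInd_eq_zero h4, arcInd_eq_zero h5]
    by_cases hu : u ∈ X
    · exact aux X h.card_left hu fun v hv => by simp [hv, hu]
    · exact aux Xᶜ h.card_right (by simpa using hu) fun v hv => by simp_all
  have hsum : ∑ u, deg A u = ∑ u, ∑ v, (arcInd A u (τ v) + arcInd A v (τ u)) := by
    simp only [deg_eq_sum, Finset.sum_add_distrib]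
    congr 1
    · exact Finset.sum_congr rfl fun u _ => (Equiv.sum_comp τ fun v => arcInd A u v).symm
    · exact (Equiv.sum_comp τ fun u => ∑ v, arcInd A v u).symm
  have hle := Finset.sum_le_card_nsmul Finset.univ _ _ fun u _ => key u
  have hge := h.le_sum_deg Finset.univ
  rw [← hsum] at hle
  rw [Finset.card_univ, h.card_eq] at hle hge
  have := Nat.le_of_mul_le_mul_left (hge.trans hle) (by omega)
  omega

theorem hasListCycle_two_mul_pred (h : BipDegreeCond A X a k) (hsc : StronglyConnected A) :
    HasListCycle A (2 * (a - 1)) := by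
  obtain ⟨L, x, y, hL, hA, hlen⟩ := h.hasListCycle_two_mul hsc
  have hall : ∀ v, v ∈ L := by
    have : L.toFinset = Finset.univ := by
      rw [← Finset.card_eq_iff_eq_univ, List.toFinset_card_of_nodup hL.nodup, hlen, h.card_eq]
    intro v
    rw [← List.mem_toFinset, this]
    exact Finset.mem_univ v
  obtain ⟨u, v, huv, huA, hvA⟩ := h.exists_exchange L.formPerm fun v => hL.arc_formPerm hA (hall v)
  obtain ⟨L', hL', hrot⟩ := hL.exists_isRotated hA (hall v)
  obtain ⟨L₁, L₂, rfl, hL₁, hL₂⟩ := hL'.exists_split ((hrot.mem_iff).1 (hall u)) huv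
  rw [← List.formPerm_eq_of_isRotated hL.nodup hrot] at hL₂
  have hlen' : L₁.length + L₂.length = 2 * a := by
    rw [← hlen, hrot.perm.length_eq, List.length_append]
  have hdisj : List.Disjoint L₁ L₂ := (List.nodup_append'.1 hL'.nodup).2.2
  have hmem : ∀ w, w ∉ L₁ → w ∈ L₂ := fun w hw => by
    simpa [hw] using (hrot.mem_iff).1 (hall w)
  have hpos := List.length_pos_of_ne_nil hL₂.ne_nil
  rcases lt_or_ge L₂.length 3 with hlt | hge
  · refine ⟨L₁, _, _, hL₁, huA, ?_⟩
    have : L₂.length ≠ 1 := by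
      intro h1
      obtain ⟨z, rfl⟩ := List.length_eq_one_iff.1 h1
      have e1 : z = L.formPerm u := by simpa using hL₂.head
      have e2 : z = v := by simpa using hL₂.last
      rw [← e1, e2] at hvA
      exact h.irrefl v hvA
    omega
  · by_contra hnot
    set φ : Equiv.Perm V := L₁.formPerm * L₂.formPerm ^ 3 with hφ
    have p1 : ∀ w ∈ L₁, φ w = L₁.formPerm w := fun w hw => by
      have : L₂.formPerm w = w := List.formPerm_apply_of_notMem (hdisj hw)
      simp [hφ, pow_succ, this]
    have q1 : ∀ w ∈ L₂, L₂.formPerm w ∈ L₂ := fun w hw => List.formPerm_apply_mem_of_mem hw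
    have q2 : ∀ w ∈ L₂, (L₂.formPerm ^ 3) w ∈ L₂ := fun w hw => by
      simpa [pow_succ] using q1 _ (q1 _ (q1 _ hw))
    have p2 : ∀ w ∈ L₂, φ w = (L₂.formPerm ^ 3) w := fun w hw => by
      rw [hφ, Equiv.Perm.mul_apply]
      exact List.formPerm_apply_of_notMem fun hw' => hdisj hw' (q2 w hw)
    have hex : ∃ u ∈ L₁, ∃ v ∉ L₁, A u (φ v) ∧ A v (φ u) := by
      by_contra! hno
      refine hnot (h.hasListCycle_of_no_exchange hsc (φ := φ) (S := L₁.toFinset)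
        (s := u) (t := v) ?_ ?_ (by simpa using hno) (by simpa using hL₁.last_mem)
        (by simpa using fun hv => hdisj hv hL₂.last_mem)).2
      · intro w
        simp only [List.mem_toFinset]
        by_cases hw : w ∈ L₁
        · simp [hw, p1 w hw, List.formPerm_apply_mem_of_mem hw]
        · simp only [hw, p2 w (hmem w hw), iff_false]
          exact fun hw' => hdisj hw' (q2 w (hmem w hw))
      · intro w
        by_cases hw : w ∈ L₁
        · have := h.bip _ _ (hL₁.arc_formPerm huA hw)
          rw [p1 w hw]
          tauto
        · have hw2 := hmem w hw
          have b1 := h.bip _ _ (hL₂.arc_formPerm hvA hw2)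
          have b2 := h.bip _ _ (hL₂.arc_formPerm hvA (q1 _ hw2))
          have b3 := h.bip _ _ (hL₂.arc_formPerm hvA (q1 _ (q1 _ hw2)))
          rw [p2 w hw2]
          simp only [pow_succ, pow_zero, one_mul, Equiv.Perm.mul_apply]
          tauto
    obtain ⟨u', hu', v', hv', h1, h2⟩ := hex
    rw [p2 v' (hmem v' hv')] at h1
    rw [p1 u' hu'] at h2
    obtain ⟨M₁, hM₁, r1⟩ := hL₁.exists_isRotated huA hu'
    obtain ⟨M₂, hM₂, r2⟩ := hL₂.exists_isRotated hvA (hmem v' hv')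
    have hl2 := r2.perm.length_eq
    have hM := hM₂.drop_two (by omega)
    rw [← List.formPerm_eq_of_isRotated hL₂.nodup r2] at hM
    refine hnot ⟨M₁ ++ M₂.drop 2, _, _, hM₁.append hM h1 ?_, h2, ?_⟩
    · exact fun w hw hw' =>
        hdisj ((r1.mem_iff).2 hw) ((r2.mem_iff).2 (List.mem_of_mem_drop hw'))
    · have hl1 := r1.perm.length_eq
      simp only [List.length_append, List.length_drop]
      omega

/-- A vertex off a cycle of length `2 * (a - 1)` lies on cycles of all smaller even lengths. -/
theorem hasListCycle_of_notMem (h : BipDegreeCond A X a k) {L : List V} {z y x : V}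
    (hL : IsDiPath A L z y) (hA : A y z) (hlen : L.length = 2 * (a - 1)) (hx : x ∉ L)
    (hxX : x ∈ X) {l : ℕ} (hl : 1 ≤ l) (hla : l ≤ a - 1) : HasListCycle A (2 * l) := by
  have h2 := h.two_le
  have h2k := h.two_mul_le
  have hflip : ∀ v ∈ L, (L.formPerm v ∈ X ↔ v ∉ X) := fun v hv => by
    have := h.bip _ _ (hL.arc_formPerm hA hv)
    tauto
  have hmem : ∀ v, L.formPerm v ∈ L ↔ v ∈ L := fun v => by
    by_cases hv : v ∈ L
    · simp [hv, List.formPerm_apply_mem_of_mem hv]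
    · simp [hv, List.formPerm_apply_of_notMem hv]
  set Q := Xᶜ ∩ L.toFinset with hQ
  have hcard : #Q = a - 1 := by
    have e1 : #(X ∩ L.toFinset) = #Q := by
      refine Finset.card_equiv L.formPerm fun v => ?_
      by_cases hv : v ∈ L
      · simp [hQ, hmem, hv, hflip v hv]
      · simp [hQ, hmem, hv]
    have e2 : #(X ∩ L.toFinset) + #Q = 2 * (a - 1) := by
      rw [← hlen, ← List.toFinset_card_of_nodup hL.nodup, hQ, Finset.inter_comm X,
        Finset.inter_comm Xᶜ, ← Finset.sdiff_eq_inter_compl, Finset.card_inter_add_card_sdiff]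
    omega
  have hpow : ∀ j v, (L.formPerm ^ (2 * j)) v ∈ Q ↔ v ∈ Q := by
    intro j
    induction j with
    | zero => simp
    | succ j ih =>
      intro v
      rw [show 2 * (j + 1) = 2 * j + 1 + 1 by ring, pow_succ, pow_succ, Equiv.Perm.mul_apply,
        Equiv.Perm.mul_apply, ih]
      by_cases hv : v ∈ L
      · simp [hQ, hmem, hv, hflip v hv, hflip _ ((hmem v).2 hv)]
      · simp [hQ, hmem, hv]
  set n := 2 * (l - 1) with hn
  obtain ⟨v, hvQ, hxv, hvx⟩ : ∃ v ∈ Q, A x v ∧ A ((L.formPerm ^ n) v) x := by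
    by_contra! hno
    have hdeg := h.le_deg x
    have s1 : ∑ v ∈ Q, (arcInd A x v + arcInd A ((L.formPerm ^ n) v) x) ≤ #Q := by
      refine (Finset.sum_le_card_nsmul _ _ 1 fun v hv => ?_).trans_eq (by simp)
      have h3 := arcInd_le_one A x v
      have h4 := arcInd_le_one A ((L.formPerm ^ n) v) x
      by_cases hA : A x v
      · rw [arcInd_eq_zero (hno v hv hA)]
        omega
      · rw [arcInd_eq_zero hA]
        omega
    have s2 : ∑ v ∈ Q, arcInd A ((L.formPerm ^ n) v) x = ∑ v ∈ Q, arcInd A v x :=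
      Finset.sum_equiv (L.formPerm ^ n) (fun v => (hpow _ v).symm) (by simp)
    rw [Finset.sum_add_distrib, s2, hcard] at s1
    have hsub : Q ⊆ Xᶜ := Finset.inter_subset_left
    have hdiff : #(Xᶜ \ Q) ≤ 1 := by
      rw [Finset.card_sdiff_of_subset hsub, h.card_right]
      omega
    have s3 : ∀ f : V → ℕ, (∀ v, f v ≤ 1) → ∑ v ∈ Xᶜ, f v ≤ ∑ v ∈ Q, f v + 1 := by
      intro f hf
      rw [← Finset.sum_sdiff hsub, add_comm]
      gcongr
      exact (Finset.sum_le_card_nsmul _ _ 1 fun v _ => hf v).trans (by simpa using hdiff)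
    have s4 := s3 (fun v => arcInd A x v) fun v => arcInd_le_one _ _ _
    have s5 := s3 (fun v => arcInd A v x) fun v => arcInd_le_one _ _ _
    rw [h.deg_eq hxX] at hdeg
    omega
  have hvL : v ∈ L := by
    have := (Finset.mem_inter.1 hvQ).2
    simpa using this
  obtain ⟨u, rfl⟩ := L.formPerm.surjective v
  obtain ⟨M, hM, hrot⟩ := hL.exists_isRotated hA ((hmem u).1 hvL)
  have hMlen : M.length = 2 * (a - 1) := by rw [← hlen, hrot.perm.length_eq]
  have hnM : n < M.length := by omega
  have h0 : M[0]'(by omega) = L.formPerm u := by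
    have := hM.head
    rw [List.head?_eq_getElem?, List.getElem?_eq_getElem (by omega)] at this
    simpa using this
  have hend : (L.formPerm ^ n) (L.formPerm u) = M[n] := by
    rw [List.formPerm_eq_of_isRotated hL.nodup hrot] at h0 ⊢
    rw [← h0, List.formPerm_pow_apply_getElem _ hM.nodup]
    simp [Nat.mod_eq_of_lt hnM]
  rw [hend] at hvx
  refine ⟨[x] ++ M.take (n + 1), _, _, (IsDiPath.singleton x).append (hM.take_succ n hnM) hxv ?_,
    hvx, ?_⟩
  · simp only [List.singleton_disjoint]
    exact fun hx' => hx ((hrot.mem_iff).2 (List.mem_of_mem_take hx'))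
  · simp only [List.length_append, List.length_singleton, List.length_take]
    omega

theorem bipancyclic (h : BipDegreeCond A X a k) (hsc : StronglyConnected A) :
    Bipancyclic A a := by
  intro l hl hla
  apply HasListCycle.hasCycleOfLength
  rcases hla.eq_or_lt with rfl | hlt
  · exact h.hasListCycle_two_mul hsc
  · obtain ⟨L, z, y, hL, hA, hlen⟩ := h.hasListCycle_two_mul_pred hsc
    obtain ⟨x, hx⟩ : ∃ x, x ∉ L := by
      by_contra! hall
      have : Fintype.card V ≤ L.length := by
        rw [← List.toFinset_card_of_nodup hL.nodup, ← Finset.card_univ]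
        exact Finset.card_le_card fun v _ => by simpa using hall v
      rw [h.card_eq] at this
      omega
    by_cases hxX : x ∈ X
    · exact h.hasListCycle_of_notMem hL hA hlen hx hxX hl (by omega)
    · exact h.symm.hasListCycle_of_notMem hL hA hlen hx (by simpa using hxX) hl (by omega)

end BipDegreeCond

/-- A strongly connected digraph without dominating pairs is a directed cycle. -/
theorem isDirectedCycleDigraph_of_no_dominating {V : Type*} [Fintype V] [Nontrivial V]
    {A : V → V → Prop} (hsc : StronglyConnected A) (hirr : ∀ v, ¬ A v v)
    (hB : ∀ u v w, A u w → A v w → u = v) : IsDirectedCycleDigraph A := by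
  classical
  have hex : ∀ v, ∃ w, A v w := by
    intro v
    obtain ⟨t, ht⟩ := exists_ne v
    obtain ⟨u, w, rfl, -, hA⟩ := hsc.exists_arc (p := (· = v)) rfl ht
    exact ⟨w, hA⟩
  choose s hs using hex
  have hinj : Function.Injective s := fun u v huv => hB u v (s u) (hs u) (huv ▸ hs v)
  let σ : Equiv.Perm V := Equiv.ofBijective s (Finite.injective_iff_bijective.1 hinj)
  have hσ : ∀ v, A v (σ v) := hs
  have huniq : ∀ u v, A u v → v = σ u := by
    intro u v hA
    obtain ⟨u', rfl⟩ := σ.surjective v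
    rw [hB u u' _ hA (hσ u')]
  obtain ⟨v₀⟩ : Nonempty V := inferInstance
  obtain ⟨L, hL, hmem⟩ := exists_isDiPath_orbit σ hσ
    (fun v hv => hirr v (by simpa [hv] using hσ v)) v₀
  have hall : ∀ v, v ∈ L := by
    intro v
    by_contra hv
    obtain ⟨u, w, hu, hw, hA⟩ := hsc.exists_arc (p := (· ∈ L)) hL.last_mem hv
    rw [huniq u w hA] at hw
    exact hw (by simpa [hmem] using hu)
  have hlen : L.length = Fintype.card V := by
    rw [← List.toFinset_card_of_nodup hL.nodup, ← Finset.card_univ]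
    congr 1
    ext v
    simp [hall]
  have hcyc := hL.hasCycleOfLength (hσ v₀)
  rw [hlen] at hcyc
  obtain ⟨f, hf, hfA⟩ := hcyc
  have hbij : Function.Bijective f :=
    (Fintype.bijective_iff_injective_and_card f).2 ⟨hf, ZMod.card _⟩
  refine ⟨Equiv.ofBijective f hbij, fun u v => ⟨fun hA => ?_, ?_⟩⟩
  · obtain ⟨i, rfl⟩ := hbij.surjective u
    exact ⟨i, rfl, (huniq _ _ hA).trans (huniq _ _ (hfA i)).symm⟩
  · rintro ⟨i, rfl, rfl⟩
    exact hfA i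

/-- condition (B_k) on dominating pairs implies bipancyclicity or a `2a`-cycle. -/
theorem stmt_11 {V : Type*} [Fintype V] (A : V → V → Prop) (a k : ℕ) (X Y : Set V)
    (ha : 3 ≤ a) (hk1 : 1 < k) (hk2 : a < 4 * k) (hk3 : 2 * k ≤ a)
    (hcard : Fintype.card V = 2 * a)
    (hbip : IsBipartition A X Y) (hX : X.ncard = a) (hY : Y.ncard = a)
    (hsc : StronglyConnected A)
    (hdeg : ∀ u v : V, IsDominatingPair A u v →
      (2 * a - k ≤ deg A u ∧ a + k ≤ deg A v) ∨
      (a + k ≤ deg A u ∧ 2 * a - k ≤ deg A v)) :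
    Bipancyclic A a ∨ IsDirectedCycleDigraph A := by
  classical
  have hXY : ∀ v, v ∈ Y ↔ v ∉ X := fun v =>
    ⟨fun hy hx => Set.disjoint_left.1 hbip.1 hx hy,
      fun hx => (hbip.2.1 ▸ Set.mem_univ v : v ∈ X ∪ Y).resolve_left hx⟩
  have harc : ∀ u v, A u v → (u ∈ X ↔ v ∉ X) := fun u v hA => by
    have := hbip.2.2 u v hA
    simp only [hXY] at this
    tauto
  by_cases hall : ∀ u, a + k ≤ deg A u
  · left
    have hcX : #X.toFinset = a := by rw [← Set.ncard_eq_toFinset_card', hX]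
    have hcond : BipDegreeCond A X.toFinset a k :=
      { two_le := hk1
        two_mul_le := hk3
        card_left := hcX
        card_right := by
          rw [Finset.card_compl, hcX, hcard]
          omega
        bip := by simpa using harc
        le_deg := hall
        large := fun u v w hne hu hv => (hdeg u v ⟨hne, w, hu, hv⟩).imp And.left And.right }
    exact hcond.bipancyclic hsc
  · right
    push Not at hall
    obtain ⟨v₀, hv₀⟩ := hall
    have hlow : ∀ v, deg A v < a + k → ∀ w u, A v w → A u w → u = v := by
      intro v hv w u hvw huw
      by_contra hne
      rcases hdeg u v ⟨hne, w, huw, hvw⟩ with h | h <;> omega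
    have hstep : ∀ v w, (∀ w u, A v w → A u w → u = v) → A v w → deg A w < a + k := by
      intro v w hv hvw
      have hin : inDeg A w ≤ 1 :=
        (Set.ncard_le_ncard (t := {v}) fun u hu => hv w u hvw hu).trans_eq (Set.ncard_singleton v)
      have hout : outDeg A w ≤ a := by
        by_cases hw : w ∈ X
        · exact hY ▸ Set.ncard_le_ncard fun u hu => (hXY u).2 ((harc w u hu).1 hw)
        · exact hX ▸ Set.ncard_le_ncard fun u hu => by
            have := harc w u hu
            tauto
      unfold deg
      omega
    have hB : ∀ v, ∀ w u, A v w → A u w → u = v := by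
      by_contra! hnot
      obtain ⟨t, ht⟩ := hnot
      obtain ⟨u, v, hu, hv, hA⟩ := hsc.exists_arc (p := fun v => ∀ w u, A v w → A u w → u = v)
        (hlow v₀ hv₀) (t := t) (by push Not; exact ht)
      exact hv (hlow v (hstep u v hu hA))
    have : Nontrivial V := Fintype.one_lt_card_iff_nontrivial.1 (by omega)
    exact isDirectedCycleDigraph_of_no_dominating hsc
      (fun v hA => by have := harc v v hA; tauto) fun u v w hu hv => hB v w u hv hu
end

section
/- Let D be a strongly connected balanced bipartite digraph of order 2a with a ≥ 3, and let k be an integer with max{1, a/4} < k ≤ a/2. Suppose for every dominated pair {u,v}: either d(u) ≥ 2a−k and d(v) ≥ a+k, or d(u) ≥ a+k and d(v) ≥ 2a−k. Then D is either bipancyclic or a directed cycle of length 2a. -/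
open Finset Function

variable {V : Type*}

section Counting

open scoped Classical

variable [Fintype V] {A : V → V → Prop} {P : Finset V} {a k : ℕ}

/-- The finset of out-neighbours of a vertex. -/
noncomputable def outN (A : V → V → Prop) (u : V) : Finset V := univ.filter fun v => A u v

/-- The finset of in-neighbours of a vertex. -/
noncomputable def inN (A : V → V → Prop) (u : V) : Finset V := univ.filter fun v => A v u

@[simp] theorem mem_outN {u v : V} : v ∈ outN A u ↔ A u v := by simp [outN]

@[simp] theorem mem_inN {u v : V} : v ∈ inN A u ↔ A v u := by simp [inN]

theorem deg_eq_card (A : V → V → Prop) (u : V) : deg A u = #(outN A u) + #(inN A u) := by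
  simp only [deg, outDeg, inDeg, outN, inN]
  rw [Set.ncard_eq_toFinset_card', Set.ncard_eq_toFinset_card', Set.toFinset_ofPred,
    Set.toFinset_ofPred]

/-- A balanced bipartite digraph with one part `P`, all degrees at least `a + k`, in which two
vertices of degree below `2a - k` never share an in-neighbour. -/
structure DenseBip (A : V → V → Prop) (P : Finset V) (a k : ℕ) : Prop where
  one_lt : 1 < k
  lt_four_mul : a < 4 * k
  two_mul_le : 2 * k ≤ a
  card_left : #P = a
  card_right : #Pᶜ = a
  bip : ∀ u v, A u v → (u ∈ P ↔ v ∉ P)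
  le_deg : ∀ v, a + k ≤ deg A v
  high : ∀ u v w, u ≠ v → A w u → A w v → 2 * a - k ≤ deg A u ∨ 2 * a - k ≤ deg A v

namespace DenseBip

theorem compl (h : DenseBip A P a k) : DenseBip A Pᶜ a k where
  one_lt := h.one_lt
  lt_four_mul := h.lt_four_mul
  two_mul_le := h.two_mul_le
  card_left := h.card_right
  card_right := by simpa using h.card_left
  bip u v huv := by have := h.bip u v huv; simp only [mem_compl]; tauto
  le_deg := h.le_deg
  high := h.high

theorem outN_subset (h : DenseBip A P a k) {u : V} (hu : u ∈ P) : outN A u ⊆ Pᶜ := by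
  intro v hv
  have := h.bip u v (mem_outN.1 hv)
  simp only [mem_compl]; tauto

theorem inN_subset (h : DenseBip A P a k) {u : V} (hu : u ∈ P) : inN A u ⊆ Pᶜ := by
  intro v hv
  have := h.bip v u (mem_inN.1 hv)
  simp only [mem_compl]; tauto

theorem card_outN_le (h : DenseBip A P a k) (u : V) : #(outN A u) ≤ a := by
  by_cases hu : u ∈ P
  · exact h.card_right ▸ card_le_card (h.outN_subset hu)
  · exact h.compl.card_right ▸ card_le_card (h.compl.outN_subset (mem_compl.2 hu))

theorem card_inN_le (h : DenseBip A P a k) (u : V) : #(inN A u) ≤ a := by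
  by_cases hu : u ∈ P
  · exact h.card_right ▸ card_le_card (h.inN_subset hu)
  · exact h.compl.card_right ▸ card_le_card (h.compl.inN_subset (mem_compl.2 hu))

theorem le_card_inN (h : DenseBip A P a k) (u : V) : k ≤ #(inN A u) := by
  have h1 := h.le_deg u
  have h2 := h.card_outN_le u
  rw [deg_eq_card] at h1
  omega

theorem sum_inN_inter_le (h : DenseBip A P a k) {L : Finset V}
    (hL : ∀ u ∈ L, deg A u < 2 * a - k) (B : Finset V) :
    ∑ u ∈ L, #(inN A u ∩ B) ≤ #B := by
  rw [← card_biUnion]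
  · exact card_le_card (biUnion_subset.2 fun u _ => inter_subset_right)
  · intro u hu v hv huv
    refine disjoint_left.2 fun w hw hw' => ?_
    simp only [mem_inter, mem_inN] at hw hw'
    have h1 := hL u hu
    have h2 := hL v hv
    rcases h.high u v w huv hw.1 hw'.1 with h3 | h3 <;> omega

theorem sum_inN_le (h : DenseBip A P a k) {L : Finset V}
    (hL : ∀ u ∈ L, deg A u < 2 * a - k) {B : Finset V} (hB : ∀ u ∈ L, inN A u ⊆ B) :
    ∑ u ∈ L, #(inN A u) ≤ #B := by
  refine le_trans (sum_le_sum fun u hu => ?_) (h.sum_inN_inter_le hL B)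
  rw [inter_eq_left.2 (hB u hu)]

theorem card_low_lt_four (h : DenseBip A P a k) {L : Finset V}
    (hL : ∀ u ∈ L, deg A u < 2 * a - k) (hP : L ⊆ P) : #L < 4 := by
  have h1 := h.sum_inN_le hL (B := Pᶜ) fun u hu => h.inN_subset (hP hu)
  have h2 : #L * k ≤ ∑ u ∈ L, #(inN A u) := by
    simpa using card_nsmul_le_sum L _ k fun u _ => h.le_card_inN u
  have h3 := h.lt_four_mul
  rw [h.card_right] at h1
  by_contra! hc
  nlinarith

theorem sum_deg_ge (h : DenseBip A P a k) (Q : Finset V) :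
    #Q * (2 * a - k) ≤
      ∑ u ∈ Q, deg A u + #(Q.filter fun u => deg A u < 2 * a - k) * (a - 2 * k) := by
  have h1 : ∑ u ∈ Q, (2 * a - k) ≤
      ∑ u ∈ Q, (deg A u + if deg A u < 2 * a - k then a - 2 * k else 0) := by
    refine sum_le_sum fun u _ => ?_
    have h2 := h.le_deg u
    have h3 := h.two_mul_le
    split_ifs <;> omega
  rw [sum_add_distrib, ← sum_filter] at h1
  simpa using h1

theorem sum_inner_le (h : DenseBip A P a k) {C : Finset V} {s : ℕ}
    (hs : #(C ∩ P) = s) (hs' : #(C ∩ Pᶜ) = s) :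
    ∑ u ∈ C ∩ P, #(inN A u ∩ C) +
      s * (#((C ∩ P).filter fun u => deg A u < 2 * a - k) - 1) ≤ s * s := by
  have hle : ∀ u ∈ C ∩ P, inN A u ∩ C = inN A u ∩ (C ∩ Pᶜ) := by
    intro u hu
    have h1 := h.inN_subset (mem_inter.1 hu).2
    ext w
    have := @h1 w
    simp only [mem_inter] at *
    tauto
  rw [sum_congr rfl fun u hu => congrArg card (hle u hu),
    ← sum_filter_add_sum_filter_not (C ∩ P) fun u => deg A u < 2 * a - k]
  have h1 := h.sum_inN_inter_le (L := (C ∩ P).filter fun u => deg A u < 2 * a - k)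
    (fun u hu => (mem_filter.1 hu).2) (C ∩ Pᶜ)
  have h2 := sum_le_card_nsmul ((C ∩ P).filter fun u => ¬ deg A u < 2 * a - k)
    (fun u => #(inN A u ∩ (C ∩ Pᶜ))) s fun u _ => hs' ▸ card_le_card inter_subset_right
  have h3 := card_filter_add_card_filter_not (s := C ∩ P) fun u => deg A u < 2 * a - k
  rw [hs'] at h1
  rw [hs] at h3
  rw [smul_eq_mul] at h2
  rcases Nat.eq_zero_or_pos #((C ∩ P).filter fun u => deg A u < 2 * a - k) with h0 | h0
  · rw [card_eq_zero] at h0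
    rw [h0] at h3 ⊢
    simp only [sum_empty, card_empty, zero_add, zero_tsub, mul_zero, add_zero] at h3 ⊢
    nlinarith
  · obtain ⟨l, hl⟩ := Nat.exists_eq_add_of_le' h0
    rw [hl] at h3 ⊢
    simp only [Nat.add_sub_cancel]
    nlinarith

theorem sum_deg_eq (A : V → V → Prop) (C : Finset V) :
    ∑ u ∈ C, deg A u =
      2 * ∑ u ∈ C, #(inN A u ∩ C) + ∑ u ∈ C, (#(outN A u \ C) + #(inN A u \ C)) := by
  have h1 : ∑ u ∈ C, #(outN A u ∩ C) = ∑ u ∈ C, #(inN A u ∩ C) := by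
    have := sum_card_bipartiteAbove_eq_sum_card_bipartiteBelow (s := C) (t := C) A
    convert this using 3 with u _ u _
    · ext w; simp [bipartiteAbove, and_comm]
    · ext w; simp [bipartiteBelow, and_comm]
  have h2 : ∀ u, deg A u =
      #(outN A u ∩ C) + #(inN A u ∩ C) + (#(outN A u \ C) + #(inN A u \ C)) := by
    intro u
    rw [deg_eq_card, ← card_inter_add_card_sdiff (outN A u) C,
      ← card_inter_add_card_sdiff (inN A u) C]
    ring
  rw [sum_congr rfl fun u _ => h2 u, sum_add_distrib, sum_add_distrib, h1]
  ring

theorem card_cross_le (h : DenseBip A P a k) {C : Finset V} {s : ℕ}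
    (hs : #(C ∩ P) = s) {ρ τ : Equiv.Perm V}
    (hρC : ∀ x, ρ x ∈ C ↔ x ∈ C) (hρP : ∀ x, ρ x ∈ P ↔ x ∉ P) (hτP : ∀ x, τ x ∈ P ↔ x ∉ P)
    (hno : ∀ u ∈ C, ∀ v ∉ C, A u (ρ v) → ¬ A v (τ u)) {u : V} (hu : u ∈ C) (huP : u ∈ P) :
    #(outN A u \ C) + #(inN A (τ u) \ C) ≤ a - s := by
  have h1 : #(outN A u \ C) = #(univ.filter fun v => v ∉ C ∧ A u (ρ v)) := by
    symm
    refine card_bij (fun v _ => ρ v) ?_ (fun _ _ _ _ e => ρ.injective e) ?_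
    · intro v hv
      simp only [mem_filter, mem_univ, true_and] at hv
      simp [hv.2, hρC, hv.1]
    · intro w hw
      refine ⟨ρ.symm w, ?_, by simp⟩
      have := hρC (ρ.symm w)
      simp only [mem_sdiff, mem_outN, Equiv.apply_symm_apply] at hw this
      simp [hw.1, ← this, hw.2]
  have h2 : #(P \ C) = a - s := by
    have := card_inter_add_card_sdiff P C
    rw [inter_comm, hs, h.card_left] at this
    omega
  rw [h1, ← h2, ← card_union_of_disjoint]
  · refine card_le_card fun v hv => ?_
    simp only [mem_union, mem_filter, mem_univ, true_and, mem_sdiff, mem_inN] at hv ⊢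
    have := hρP v
    have := hτP u
    rcases hv with hv | hv
    · have := h.bip _ _ hv.2
      tauto
    · have := h.bip _ _ hv.1
      tauto
  · rw [disjoint_left]
    intro v hv hv'
    simp only [mem_filter, mem_univ, true_and, mem_sdiff, mem_inN] at hv hv'
    exact hno u hu v hv.1 hv.2 hv'.1

theorem sum_cross_le (h : DenseBip A P a k) {C : Finset V} {s : ℕ}
    (hs : #(C ∩ P) = s) (hs' : #(C ∩ Pᶜ) = s) {ρ τ : Equiv.Perm V}
    (hρC : ∀ x, ρ x ∈ C ↔ x ∈ C) (hρP : ∀ x, ρ x ∈ P ↔ x ∉ P)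
    (hτC : ∀ x, τ x ∈ C ↔ x ∈ C) (hτP : ∀ x, τ x ∈ P ↔ x ∉ P)
    (hno : ∀ u ∈ C, ∀ v ∉ C, A u (ρ v) → ¬ A v (τ u)) :
    ∑ u ∈ C, (#(outN A u \ C) + #(inN A u \ C)) ≤ 2 * (s * (a - s)) := by
  have h1 : ∑ u ∈ C, #(inN A u \ C) = ∑ u ∈ C, #(inN A (τ u) \ C) := by
    symm
    refine sum_bij (fun u _ => τ u) (fun u hu => (hτC u).2 hu)
      (fun _ _ _ _ e => τ.injective e) (fun w hw => ⟨τ.symm w, ?_, by simp⟩) fun _ _ => rfl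
    rw [← hτC]; simpa using hw
  rw [sum_add_distrib, h1, ← sum_add_distrib]
  have h2 : ∀ u ∈ C, #(outN A u \ C) + #(inN A (τ u) \ C) ≤ a - s := by
    intro u hu
    by_cases huP : u ∈ P
    · exact h.card_cross_le hs hρC hρP hτP hno hu huP
    · refine h.compl.card_cross_le hs' hρC ?_ ?_ hno hu (mem_compl.2 huP)
      · intro x; simp [hρP]
      · intro x; simp [hτP]
  have h3 : #C = 2 * s := by
    have := card_inter_add_card_sdiff C P
    rw [sdiff_eq_inter_compl, hs, hs'] at this
    omega
  refine (sum_le_card_nsmul C _ _ h2).trans_eq ?_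
  rw [h3, smul_eq_mul]; ring

theorem low_bound {k t s l : ℤ} (hk : 2 ≤ k) (ht : 1 ≤ t) (htk : t < 2 * k) (hks : k ≤ s)
    (hs : 2 * s ≤ 2 * k + t) (hl : 1 ≤ l) (hl3 : l ≤ 3) :
    l * t < s * (k + t - s) + 2 * s * (l - 1) := by
  have h1 : s * t ≤ 2 * (s * (k + t - s)) := by nlinarith
  obtain rfl | rfl | rfl : l = 1 ∨ l = 2 ∨ l = 3 := by omega
  · rcases eq_or_lt_of_le hks with rfl | h2
    · nlinarith
    · nlinarith
  · rcases eq_or_lt_of_le hks with rfl | h2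
    · nlinarith
    · rcases le_or_gt s 3 with h3 | h3
      · obtain rfl : s = 3 := by omega
        nlinarith
      · nlinarith
  · nlinarith

/-- If no exchange joins `C` to its complement, then `C` is exactly half of a digraph with
`a = 2k` and induces a complete bipartite digraph. -/
theorem complete_of_no_exchange (h : DenseBip A P a k) {C : Finset V} {s : ℕ}
    (hs : #(C ∩ P) = s) (hs' : #(C ∩ Pᶜ) = s) (h0 : 0 < s) (hsa : 2 * s ≤ a)
    {ρ τ : Equiv.Perm V}
    (hρC : ∀ x, ρ x ∈ C ↔ x ∈ C) (hρP : ∀ x, ρ x ∈ P ↔ x ∉ P)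
    (hτC : ∀ x, τ x ∈ C ↔ x ∈ C) (hτP : ∀ x, τ x ∈ P ↔ x ∉ P)
    (hno : ∀ u ∈ C, ∀ v ∉ C, A u (ρ v) → ¬ A v (τ u)) :
    a = 2 * k ∧ s = k ∧ ∀ u ∈ C, ∀ w ∈ C, (u ∈ P ↔ w ∉ P) → A u w := by
  have hk := h.one_lt
  have hcross := h.sum_cross_le hs hs' hρC hρP hτC hτP hno
  have hdeg := sum_deg_eq A C
  have hsplit : ∀ f : V → ℕ, ∑ u ∈ C, f u = ∑ u ∈ C ∩ P, f u + ∑ u ∈ C ∩ Pᶜ, f u := by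
    intro f
    rw [← sdiff_eq_inter_compl, sum_inter_add_sum_sdiff]
  have hi1 := h.sum_inner_le hs hs'
  have hi2 := h.compl.sum_inner_le hs' (by simpa using hs)
  have hd1 := h.sum_deg_ge (C ∩ P)
  have hd2 := h.sum_deg_ge (C ∩ Pᶜ)
  have hl1 := h.card_low_lt_four (L := (C ∩ P).filter fun u => deg A u < 2 * a - k)
    (fun u hu => (mem_filter.1 hu).2) ((filter_subset _ _).trans inter_subset_right)
  have hl2 := h.compl.card_low_lt_four (L := (C ∩ Pᶜ).filter fun u => deg A u < 2 * a - k)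
    (fun u hu => (mem_filter.1 hu).2) ((filter_subset _ _).trans inter_subset_right)
  rw [hs] at hd1
  rw [hs'] at hd2
  have hC : #C = 2 * s := by
    have := card_inter_add_card_sdiff C P
    rw [sdiff_eq_inter_compl, hs, hs'] at this
    omega
  have hdeg_ge : 2 * s * (a + k) ≤ ∑ u ∈ C, deg A u := by
    rw [← hC]
    simpa using card_nsmul_le_sum C (deg A) _ fun u _ => h.le_deg u
  have hD := hsplit (deg A)
  have hI := hsplit fun u => #(inN A u ∩ C)
  generalize #((C ∩ P).filter fun u => deg A u < 2 * a - k) = l₁ at *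
  generalize #((C ∩ Pᶜ).filter fun u => deg A u < 2 * a - k) = l₂ at *
  generalize hD₁ : ∑ u ∈ C ∩ P, deg A u = D₁ at *
  generalize hD₂ : ∑ u ∈ C ∩ Pᶜ, deg A u = D₂ at *
  generalize hI₁ : ∑ u ∈ C ∩ P, #(inN A u ∩ C) = I₁ at *
  generalize hI₂ : ∑ u ∈ C ∩ Pᶜ, #(inN A u ∩ C) = I₂ at *
  generalize ∑ u ∈ C, (#(outN A u \ C) + #(inN A u \ C)) = B at *
  have h2k := h.two_mul_le
  have h4k := h.lt_four_mul
  obtain ⟨t, rfl⟩ := Nat.exists_eq_add_of_le h2k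
  obtain ⟨r, hr⟩ := Nat.exists_eq_add_of_le (show s ≤ 2 * k + t by omega)
  have hr' : 2 * k + t - s = r := by omega
  have e1 : 2 * (2 * k + t) - k = 3 * k + 2 * t := by omega
  have e2 : 2 * k + t - 2 * k = t := by omega
  rw [hr'] at hcross
  rw [e1, e2] at hd1 hd2
  have hi1' : I₁ ≤ s * s := by omega
  have hi2' : I₂ ≤ s * s := by omega
  have hks : k ≤ s := by
    by_contra! hlt
    nlinarith
  have ht : t = 0 := by
    by_contra! ht
    have key : ∀ l : ℕ, l < 4 →
        (l : ℤ) * t < s * (k + t - s) + 2 * s * ((l - 1 : ℕ) : ℤ) := by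
      intro l hl
      rcases Nat.eq_zero_or_pos l with rfl | hl0
      · have : (0 : ℤ) < s * (k + t - s) := mul_pos (by omega) (by omega)
        simpa using this
      · have := low_bound (k := k) (t := t) (s := s) (l := l) (by omega) (by omega) (by omega)
          (by omega) (by omega) (by omega) (by omega)
        push_cast [Nat.cast_sub hl0]
        exact this
    have k1 := key l₁ hl1
    have k2 := key l₂ hl2
    generalize l₁ - 1 = m₁ at *
    generalize l₂ - 1 = m₂ at *
    have hr3 : (r : ℤ) = 2 * k + t - s := by omega
    have hS : D₁ + D₂ = 2 * (I₁ + I₂) + B := by rw [← hD, ← hI, hdeg]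
    zify at hd1 hd2 hi1 hi2 hcross hS
    rw [hr3] at hcross
    linarith only [hd1, hd2, hi1, hi2, hcross, hS, k1, k2]
  subst ht
  have hsk : s = k := by omega
  subst hsk
  refine ⟨rfl, rfl, fun u hu w hw huw => ?_⟩
  have hr2 : r = s := by omega
  subst hr2
  have hle : ∀ w ∈ C, #(inN A w ∩ C) ≤ #(univ.filter fun v => v ∈ C ∧ (v ∈ P ↔ w ∉ P)) := by
    intro w _
    refine card_le_card fun v hv => ?_
    simp only [mem_inter, mem_inN, mem_filter, mem_univ, true_and] at hv ⊢
    exact ⟨hv.2, h.bip _ _ hv.1⟩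
  have hcard : ∀ w, #(univ.filter fun v => v ∈ C ∧ (v ∈ P ↔ w ∉ P)) = r := by
    intro w
    by_cases hwP : w ∈ P
    · rw [← hs']; congr 1; ext v; simp [hwP]
    · rw [← hs]; congr 1; ext v; simp [hwP]
  have heq : ∑ w ∈ C, #(inN A w ∩ C) =
      ∑ w ∈ C, #(univ.filter fun v => v ∈ C ∧ (v ∈ P ↔ w ∉ P)) := by
    refine le_antisymm (sum_le_sum hle) ?_
    simp only [hcard, sum_const, hC, smul_eq_mul]
    nlinarith
  have heq' := (sum_eq_sum_iff_of_le hle).1 heq w hw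
  have hsub : inN A w ∩ C ⊆ univ.filter fun v => v ∈ C ∧ (v ∈ P ↔ w ∉ P) := by
    intro v hv
    simp only [mem_inter, mem_inN, mem_filter, mem_univ, true_and] at hv ⊢
    exact ⟨hv.2, h.bip _ _ hv.1⟩
  have := eq_of_subset_of_card_le hsub heq'.ge
  have hmem : u ∈ inN A w ∩ C := by
    rw [this]; simp [hu, huw]
  exact mem_inN.1 (mem_inter.1 hmem).1

end DenseBip

end Counting

section Orbits

open scoped Classical

/-- `C` is a cycle (orbit) of the permutation `σ`. -/
def IsOrbit (σ : Equiv.Perm V) (C : Finset V) : Prop :=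
  C.Nonempty ∧ ∀ x ∈ C, ∀ y, y ∈ C ↔ σ.SameCycle x y

theorem IsOrbit.apply_mem_iff {σ : Equiv.Perm V} {C : Finset V} (hC : IsOrbit σ C) (x : V) :
    σ x ∈ C ↔ x ∈ C := by
  constructor
  · intro hx
    exact (hC.2 _ hx _).2 (Equiv.Perm.sameCycle_apply_left.2 (Equiv.Perm.SameCycle.refl σ x))
  · intro hx
    exact (hC.2 _ hx _).2 (Equiv.Perm.sameCycle_apply_right.2 (Equiv.Perm.SameCycle.refl σ x))

theorem pow_apply_mem_iff {σ : Equiv.Perm V} {C : Finset V} (hC : ∀ x, σ x ∈ C ↔ x ∈ C)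
    (n : ℕ) (x : V) : (σ ^ n) x ∈ C ↔ x ∈ C := by
  induction n with
  | zero => simp
  | succ n ih => rw [pow_succ', Equiv.Perm.mul_apply, hC, ih]

theorem isOrbit_of_forall {σ : Equiv.Perm V} {C : Finset V} {x : V} (hx : x ∈ C)
    (h : ∀ y, y ∈ C ↔ σ.SameCycle x y) : IsOrbit σ C :=
  ⟨⟨x, hx⟩, fun z hz y => (h y).trans
    ⟨fun hy => ((h z).1 hz).symm.trans hy, fun hy => ((h z).1 hz).trans hy⟩⟩

theorem IsOrbit.subset_of_inter {σ : Equiv.Perm V} {C Q : Finset V} (hC : IsOrbit σ C) {x : V}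
    (hx : x ∈ C) (hxQ : x ∈ Q) (hQ : ∀ y, σ y ∈ Q ↔ y ∈ Q) : C ⊆ Q := by
  intro y hy
  obtain ⟨i, rfl⟩ := (hC.2 x hx y).1 hy
  have hinv : ∀ y, σ⁻¹ y ∈ Q ↔ y ∈ Q := fun y => by rw [← hQ (σ⁻¹ y)]; simp
  rcases i with n | n
  · simpa using (pow_apply_mem_iff hQ n x).2 hxQ
  · rw [zpow_negSucc, ← inv_pow]
    exact (pow_apply_mem_iff hinv (n + 1) x).2 hxQ

variable [Fintype V] {A : V → V → Prop} {P : Finset V}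

theorem exists_isOrbit (σ : Equiv.Perm V) (x : V) : ∃ C, IsOrbit σ C ∧ x ∈ C :=
  have h : ∀ y, y ∈ univ.filter (fun y => σ.SameCycle x y) ↔ σ.SameCycle x y := by simp
  ⟨univ.filter fun y => σ.SameCycle x y,
    isOrbit_of_forall ((h x).2 (Equiv.Perm.SameCycle.refl σ x)) h,
    (h x).2 (Equiv.Perm.SameCycle.refl σ x)⟩

theorem IsOrbit.card_eq {σ : Equiv.Perm V} {C : Finset V} (hC : IsOrbit σ C) {x : V}
    (hx : x ∈ C) : #C = minimalPeriod σ x := by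
  have : C = (range (minimalPeriod σ x)).image fun i => σ^[i] x := by
    ext y
    rw [hC.2 x hx y]
    simp only [mem_image, mem_range]
    constructor
    · intro h
      obtain ⟨i, -, -, rfl⟩ := h.exists_pow_eq''
      refine ⟨i % minimalPeriod σ x, Nat.mod_lt _ ?_, ?_⟩
      · exact minimalPeriod_pos_of_mem_periodicPts (σ.injective.mem_periodicPts x)
      · rw [iterate_mod_minimalPeriod_eq, Equiv.Perm.iterate_eq_pow]
    · rintro ⟨i, -, rfl⟩
      exact ⟨i, by rw [Equiv.Perm.iterate_eq_pow]; simp⟩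
  rw [this, card_image_of_injOn, card_range]
  intro i hi j hj hij
  exact iterate_injOn_Iio_minimalPeriod (by simpa using hi) (by simpa using hj) hij

omit [Fintype V] in
theorem hasCycleOfLength_of_seq {l : ℕ} (hl : 0 < l) (h : ℕ → V)
    (hinj : Set.InjOn h (Set.Iio l)) (hstep : ∀ i, i + 1 < l → A (h i) (h (i + 1)))
    (hlast : A (h (l - 1)) (h 0)) : HasCycleOfLength A l := by
  have : NeZero l := ⟨hl.ne'⟩
  refine ⟨fun i => h i.val, fun i j hij => ?_, fun i => ?_⟩
  · exact ZMod.val_injective l (hinj (ZMod.val_lt i) (ZMod.val_lt j) hij)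
  · have h1 := ZMod.val_lt i
    rcases lt_or_ge (i.val + 1) l with h2 | h2
    · have h3 : (i + 1).val = i.val + 1 := by
        have h4 := ZMod.val_natCast_of_lt h2
        rwa [Nat.cast_succ, ZMod.natCast_zmod_val] at h4
      simpa only [h3] using hstep _ h2
    · have h3 : i + 1 = 0 := by
        have h4 : ((i.val + 1 : ℕ) : ZMod l) = ((l : ℕ) : ZMod l) := by congr 1; omega
        simpa using h4
      have h5 : i.val = l - 1 := by omega
      simpa only [h3, h5, ZMod.val_zero] using hlast

theorem IsOrbit.hasCycleOfLength {σ : Equiv.Perm V} {C : Finset V} (hC : IsOrbit σ C)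
    (hA : ∀ z ∈ C, A z (σ z)) : HasCycleOfLength A #C := by
  obtain ⟨x, hx⟩ := hC.1
  have hmem : ∀ i, σ^[i] x ∈ C := fun i => by
    rw [Equiv.Perm.iterate_eq_pow]; exact (pow_apply_mem_iff hC.apply_mem_iff i x).2 hx
  have hpos := card_pos.2 hC.1
  refine hasCycleOfLength_of_seq hpos (fun i => σ^[i] x) ?_ ?_ ?_
  · rw [hC.card_eq hx]; exact iterate_injOn_Iio_minimalPeriod
  · intro i _
    simpa only [iterate_succ_apply'] using hA _ (hmem i)
  · have h1 := hA _ (hmem (#C - 1))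
    rw [← iterate_succ_apply' σ, Nat.succ_eq_add_one, Nat.sub_add_cancel hpos] at h1
    rw [hC.card_eq hx] at h1 ⊢
    simpa only [iterate_minimalPeriod, iterate_zero, id_eq] using h1

/-- A vertex off a cycle with enough neighbours on it yields all shorter even cycles. -/
theorem IsOrbit.hasCycleOfLength_of_notMem {σ : Equiv.Perm V} {C : Finset V} (hC : IsOrbit σ C)
    (hA : ∀ z ∈ C, A z (σ z)) (hbip : ∀ u v, A u v → (u ∈ P ↔ v ∉ P)) {v : V} (hv : v ∉ C)
    {m : ℕ} (hm : #(C ∩ univ.filter fun w => w ∈ P ↔ v ∉ P) = m) (hm2 : #C = 2 * m)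
    (hdeg : m < #(outN A v ∩ C) + #(inN A v ∩ C)) {l : ℕ} (hl : 1 ≤ l) (hlm : l ≤ m) :
    HasCycleOfLength A (2 * l) := by
  have hinv := pow_apply_mem_iff hC.apply_mem_iff
  have hpar : ∀ n, ∀ w ∈ C, ((σ ^ (2 * n)) w ∈ P ↔ w ∈ P) := by
    intro n w hw
    induction n with
    | zero => simp
    | succ n ih =>
      rw [show 2 * (n + 1) = 2 * n + 1 + 1 by ring, pow_succ', pow_succ', Equiv.Perm.mul_apply,
        Equiv.Perm.mul_apply]
      have h1 := (hinv (2 * n) w).2 hw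
      have h2 := hbip _ _ (hA _ h1)
      have h3 := hbip _ _ (hA _ ((hC.apply_mem_iff _).2 h1))
      tauto
  have hcard : #(C.filter fun w => A ((σ ^ (2 * (l - 1))) w) v) = #(inN A v ∩ C) := by
    refine card_bij (fun w _ => (σ ^ (2 * (l - 1))) w) ?_
      (fun _ _ _ _ e => (σ ^ (2 * (l - 1))).injective e) ?_
    · intro w hw
      rw [mem_filter] at hw
      simpa [hinv] using hw.symm
    · intro w hw
      refine ⟨(σ ^ (2 * (l - 1))).symm w, ?_, by simp⟩
      have := hinv (2 * (l - 1)) ((σ ^ (2 * (l - 1))).symm w)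
      simp only [Equiv.apply_symm_apply, mem_inter, mem_inN, mem_filter] at this hw ⊢
      tauto
  obtain ⟨w, hw⟩ : ((outN A v ∩ C) ∩
      C.filter fun w => A ((σ ^ (2 * (l - 1))) w) v).Nonempty := by
    by_contra hemp
    rw [not_nonempty_iff_eq_empty, ← disjoint_iff_inter_eq_empty] at hemp
    have h1 : (outN A v ∩ C) ∪ (C.filter fun w => A ((σ ^ (2 * (l - 1))) w) v) ⊆
        C ∩ univ.filter fun w => w ∈ P ↔ v ∉ P := by
      intro w hw
      simp only [mem_union, mem_inter, mem_outN, mem_filter, mem_univ, true_and] at hw ⊢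
      rcases hw with hw | hw
      · have := hbip _ _ hw.1
        tauto
      · have := hbip _ _ hw.2
        have := hpar (l - 1) w hw.1
        tauto
    have h2 := card_le_card h1
    rw [card_union_of_disjoint hemp] at h2
    omega
  simp only [mem_inter, mem_outN, mem_filter] at hw
  have hmem : ∀ i, σ^[i] w ∈ C := fun i => by
    rw [Equiv.Perm.iterate_eq_pow]; exact (hinv i w).2 hw.2.1
  refine hasCycleOfLength_of_seq (by omega) (fun i => i.casesOn v fun t => σ^[t] w) ?_ ?_ ?_
  · intro i hi j hj hij
    rcases i with _ | i <;> rcases j with _ | j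
    · rfl
    · exact absurd (hmem j) (by simpa [← hij] using hv)
    · exact absurd (hmem i) (by simpa [hij] using hv)
    · congr 1
      have hp := hC.card_eq hw.2.1
      simp only [Set.mem_Iio] at hi hj
      exact iterate_injOn_Iio_minimalPeriod (show i < minimalPeriod σ w by omega)
        (show j < minimalPeriod σ w by omega) hij
  · intro i _
    rcases i with _ | i
    · exact hw.1.1
    · simpa only [iterate_succ_apply'] using hA _ (hmem i)
  · obtain ⟨l, rfl⟩ := Nat.exists_eq_add_of_le' hl
    have := hw.2.2
    rw [Nat.add_sub_cancel, ← Equiv.Perm.iterate_eq_pow] at this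
    exact this

theorem sameCycle_mul_swap {σ : Equiv.Perm V} {u v : V} (huv : ¬ σ.SameCycle u v) {z : V}
    (hz : σ.SameCycle u z) : (σ * Equiv.swap u v).SameCycle v z := by
  have hvu : (σ * Equiv.swap u v) v = σ u := by simp
  have key : ∀ n : ℕ, (σ * Equiv.swap u v).SameCycle v ((σ ^ n) (σ u)) := by
    intro n
    have hbase : (σ * Equiv.swap u v).SameCycle v (σ u) := by
      rw [← hvu]; exact Equiv.Perm.sameCycle_apply_right.2 (Equiv.Perm.SameCycle.refl _ _)
    induction n with
    | zero => simpa using hbase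
    | succ n ih =>
      rw [pow_succ', Equiv.Perm.mul_apply]
      by_cases h1 : (σ ^ n) (σ u) = u
      · rwa [h1]
      · have h2 : (σ ^ n) (σ u) ≠ v := by
          intro h2
          refine huv ⟨(n + 1 : ℕ), ?_⟩
          rw [zpow_natCast, pow_succ, Equiv.Perm.mul_apply, h2]
        have h3 : (σ * Equiv.swap u v) ((σ ^ n) (σ u)) = σ ((σ ^ n) (σ u)) := by
          rw [Equiv.Perm.mul_apply, Equiv.swap_apply_of_ne_of_ne h1 h2]
        rw [← h3]
        exact Equiv.Perm.sameCycle_apply_right.2 ih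
  obtain ⟨n, -, -, hn⟩ := (Equiv.Perm.sameCycle_apply_left.2 hz).exists_pow_eq''
  exact hn ▸ key n

/-- Multiplying by a transposition of points in different cycles merges the cycles. -/
theorem sameCycle_mul_swap_union {σ : Equiv.Perm V} {u v : V} (huv : ¬ σ.SameCycle u v) {z : V}
    (hz : σ.SameCycle u z ∨ σ.SameCycle v z) : (σ * Equiv.swap u v).SameCycle u z := by
  have h1 := sameCycle_mul_swap huv (Equiv.Perm.SameCycle.refl σ u)
  rcases hz with hz | hz
  · exact h1.symm.trans (sameCycle_mul_swap huv hz)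
  · have := sameCycle_mul_swap (fun h => huv h.symm) hz
    rwa [Equiv.swap_comm] at this

/-- Bypassing the successor of `u` removes only that successor from the cycle of `u`. -/
theorem sameCycle_bypass {σ : Equiv.Perm V} {u : V} {z : V} (hz : σ.SameCycle u z)
    (hzu : z ≠ σ u) : (σ * Equiv.swap u (σ u)).SameCycle u z := by
  have key : ∀ n : ℕ, (σ ^ n) u = σ u ∨ (σ * Equiv.swap u (σ u)).SameCycle u ((σ ^ n) u) := by
    intro n
    induction n with
    | zero => exact Or.inr (by simpa using Equiv.Perm.SameCycle.refl _ _)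
    | succ n ih =>
      rw [pow_succ', Equiv.Perm.mul_apply]
      by_cases h1 : (σ ^ n) u = u
      · exact Or.inl (by rw [h1])
      by_cases h2 : (σ ^ n) u = σ u
      · right
        have h3 : (σ * Equiv.swap u (σ u)) u = σ (σ u) := by simp
        rw [h2, ← h3]
        exact Equiv.Perm.sameCycle_apply_right.2 (Equiv.Perm.SameCycle.refl _ _)
      · right
        have h3 : (σ * Equiv.swap u (σ u)) ((σ ^ n) u) = σ ((σ ^ n) u) := by
          rw [Equiv.Perm.mul_apply, Equiv.swap_apply_of_ne_of_ne h1 h2]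
        rw [← h3]
        exact Equiv.Perm.sameCycle_apply_right.2 (ih.resolve_left h2)
  obtain ⟨n, -, -, rfl⟩ := hz.exists_pow_eq''
  exact (key n).resolve_left hzu

/-- A factor leaving `C` invariant meets both parts of `C` equally often. -/
theorem card_inter_eq_card_inter_compl {σ : Equiv.Perm V} {C : Finset V}
    (hA : ∀ z ∈ C, A z (σ z)) (hC : ∀ x, σ x ∈ C ↔ x ∈ C)
    (hbip : ∀ u v, A u v → (u ∈ P ↔ v ∉ P)) : #(C ∩ P) = #(C ∩ Pᶜ) := by
  apply le_antisymm
  · refine card_le_card_of_injOn σ (fun x hx => ?_) σ.injective.injOn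
    simp only [coe_inter, Set.mem_inter_iff, mem_coe, mem_compl] at hx ⊢
    have := hbip _ _ (hA x hx.1)
    have := hC x
    tauto
  · refine card_le_card_of_injOn σ (fun x hx => ?_) σ.injective.injOn
    simp only [coe_inter, Set.mem_inter_iff, mem_coe, mem_compl] at hx ⊢
    have := hbip _ _ (hA x hx.1)
    have := hC x
    tauto

end Orbits

section Factor

open scoped Classical

variable [Fintype V] {A : V → V → Prop} {P : Finset V} {a k : ℕ}

theorem exists_perm_of_injOn (hbip : ∀ u v, A u v → (u ∈ P ↔ v ∉ P)) {m n : V → V}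
    (hm : Set.InjOn m P) (hmA : ∀ u ∈ P, A u (m u))
    (hn : Set.InjOn n (Pᶜ : Finset V)) (hnA : ∀ u ∉ P, A u (n u)) :
    ∃ σ : Equiv.Perm V, (∀ v, A v (σ v)) ∧ (∀ v ∈ P, σ v = m v) ∧ ∀ v ∉ P, σ v = n v := by
  have hinj : Injective fun v => if v ∈ P then m v else n v := by
    intro x y hxy
    by_cases hx : x ∈ P <;> by_cases hy : y ∈ P <;> simp only [hx, hy, if_true, if_false] at hxy
    · exact hm hx hy hxy
    · have h1 := hbip _ _ (hmA x hx)
      have h2 := hbip _ _ (hnA y hy)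
      rw [hxy] at h1
      tauto
    · have h1 := hbip _ _ (hmA y hy)
      have h2 := hbip _ _ (hnA x hx)
      rw [hxy] at h2
      tauto
    · exact hn (by simpa using hx) (by simpa using hy) hxy
  refine ⟨Equiv.ofBijective _ (Finite.injective_iff_bijective.1 hinj), fun v => ?_,
    fun v hv => by simp [hv], fun v hv => by simp [hv]⟩
  by_cases hv : v ∈ P
  · simpa [hv] using hmA v hv
  · simpa [hv] using hnA v hv

namespace DenseBip

/-- A Hall obstruction only occurs in one extremal configuration. -/
theorem obstruction (h : DenseBip A P a k) {S T : Finset V} (hS : S ⊆ P) (hT : T ⊆ Pᶜ)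
    (hS0 : S.Nonempty) (hT0 : T.Nonempty) (hno : ∀ u ∈ S, ∀ w ∈ T, ¬ A u w)
    (hcard : a ≤ #S + #T) : a = 2 * k ∧ #S = k ∧ #T = k := by
  have hk := h.one_lt
  have h2k := h.two_mul_le
  have h4k := h.lt_four_mul
  have hPS : #(P \ S) = a - #S := by rw [card_sdiff_of_subset hS, h.card_left]
  have hPT : #(Pᶜ \ T) = a - #T := by rw [card_sdiff_of_subset hT, h.card_right]
  have hSa : #S ≤ a := h.card_left ▸ card_le_card hS
  have hTa : #T ≤ a := h.card_right ▸ card_le_card hT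
  have hout : ∀ u ∈ S, #(outN A u) ≤ a - #T := by
    intro u hu
    rw [← hPT]
    refine card_le_card fun w hw => mem_sdiff.2 ⟨h.outN_subset (hS hu) hw, fun hwT => ?_⟩
    exact hno u hu w hwT (mem_outN.1 hw)
  have hsubin : ∀ w ∈ T, inN A w ⊆ P \ S := by
    intro w hw u hu
    refine mem_sdiff.2 ⟨?_, fun huS => hno u huS w hw (mem_inN.1 hu)⟩
    simpa using h.compl.inN_subset (hT hw) hu
  have hin : ∀ w ∈ T, #(inN A w) ≤ a - #S := fun w hw => hPS ▸ card_le_card (hsubin w hw)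
  obtain ⟨u, hu, hud⟩ : ∃ u ∈ S, 2 * a - k ≤ deg A u := by
    by_contra! hlow
    have h1 := h.sum_inN_le hlow (B := Pᶜ) fun u hu => h.inN_subset (hS hu)
    have h2 := h.card_low_lt_four hlow hS
    have h3 : #S * (a + k) ≤ ∑ u ∈ S, deg A u := by
      simpa using card_nsmul_le_sum S (deg A) _ fun u _ => h.le_deg u
    have h4 : ∑ u ∈ S, #(outN A u) ≤ #S * (a - #T) := by
      simpa using sum_le_card_nsmul S _ _ hout
    have h5 : ∑ u ∈ S, deg A u = ∑ u ∈ S, #(outN A u) + ∑ u ∈ S, #(inN A u) := by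
      rw [← sum_add_distrib]; exact sum_congr rfl fun u _ => deg_eq_card A u
    have h6 : #S * (a - #T) ≤ #S * #S := Nat.mul_le_mul_left _ (by omega)
    have h7 := card_pos.2 hS0
    rw [h.card_right] at h1
    generalize #S = s at *
    interval_cases s <;> omega
  obtain ⟨w, hw, hwd⟩ : ∃ w ∈ T, 2 * a - k ≤ deg A w := by
    by_contra! hlow
    have h1 := h.sum_inN_le hlow hsubin
    have h2 : #T * k ≤ ∑ w ∈ T, #(inN A w) := by
      simpa using card_nsmul_le_sum T _ _ fun w _ => h.le_card_inN w
    have h3 := card_pos.2 hT0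
    have : #T * 2 ≤ #T * k := Nat.mul_le_mul_left _ hk
    omega
  rw [deg_eq_card] at hud hwd
  have h1 := hout u hu
  have h2 := hin w hw
  have h3 := h.card_inN_le u
  have h4 := h.card_outN_le w
  omega

/-- In the extremal configuration all arcs not excluded by it are present. -/
theorem obstruction_arcs (h : DenseBip A P a k) {S T : Finset V} (hS : S ⊆ P) (hT : T ⊆ Pᶜ)
    (hno : ∀ u ∈ S, ∀ w ∈ T, ¬ A u w) (ha : a = 2 * k) (hSk : #S = k) (hTk : #T = k) :
    (∀ u ∈ S, ∀ w ∈ Pᶜ \ T, A u w ∧ A w u) ∧ ∀ w ∈ T, ∀ u ∈ P \ S, A u w ∧ A w u := by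
  have hPS : #(P \ S) = k := by rw [card_sdiff_of_subset hS, h.card_left]; omega
  have hPT : #(Pᶜ \ T) = k := by rw [card_sdiff_of_subset hT, h.card_right]; omega
  have hP := h.card_left
  have hP' := h.card_right
  constructor
  · intro u hu
    have h1 : outN A u ⊆ Pᶜ \ T := fun w hw =>
      mem_sdiff.2 ⟨h.outN_subset (hS hu) hw, fun hwT => hno u hu w hwT (mem_outN.1 hw)⟩
    have h2 := h.inN_subset (hS hu)
    have h3 := h.le_deg u
    rw [deg_eq_card] at h3
    have h4 := card_le_card h1
    have h5 := card_le_card h2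
    have h6 := eq_of_subset_of_card_le h1 (by omega)
    have h7 := eq_of_subset_of_card_le h2 (by omega)
    intro w hw
    exact ⟨mem_outN.1 (h6 ▸ hw), mem_inN.1 (h7 ▸ (mem_sdiff.1 hw).1)⟩
  · intro w hw
    have h1 : inN A w ⊆ P \ S := fun u hu =>
      mem_sdiff.2 ⟨by simpa using h.compl.inN_subset (hT hw) hu,
        fun huS => hno u huS w hw (mem_inN.1 hu)⟩
    have h2 : outN A w ⊆ P := by simpa using h.compl.outN_subset (hT hw)
    have h3 := h.le_deg w
    rw [deg_eq_card] at h3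
    have h4 := card_le_card h1
    have h5 := card_le_card h2
    have h6 := eq_of_subset_of_card_le h1 (by omega)
    have h7 := eq_of_subset_of_card_le h2 (by omega)
    intro u hu
    exact ⟨mem_inN.1 (h6 ▸ hu), mem_outN.1 (h7 ▸ (mem_sdiff.1 hu).1)⟩

theorem exists_factor_of_obstruction (h : DenseBip A P a k) {S T : Finset V} (hS : S ⊆ P)
    (hT : T ⊆ Pᶜ) (hno : ∀ u ∈ S, ∀ w ∈ T, ¬ A u w) (ha : a = 2 * k) (hSk : #S = k)
    (hTk : #T = k) : ∃ σ : Equiv.Perm V, (∀ v, A v (σ v)) ∧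
      ∃ Q : Finset V, Q.Nonempty ∧ Q ≠ univ ∧ ∀ v, σ v ∈ Q ↔ v ∈ Q := by
  obtain ⟨h1, h2⟩ := h.obstruction_arcs hS hT hno ha hSk hTk
  have hk := h.one_lt
  have hPS : #(P \ S) = k := by rw [card_sdiff_of_subset hS, h.card_left]; omega
  have hPT : #(Pᶜ \ T) = k := by rw [card_sdiff_of_subset hT, h.card_right]; omega
  obtain ⟨x, hx⟩ := card_pos.1 (show 0 < #S by omega)
  obtain ⟨y, hy⟩ := card_pos.1 (show 0 < #T by omega)
  have : Nonempty V := ⟨x⟩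
  have hex : ∀ B C : Finset V, #B = #C → ∃ f : V → V, Set.BijOn f B C := fun B C hBC =>
    B.finite_toSet.exists_bijOn_of_encard_eq (by simp [Set.encard_coe_eq_coe_finsetCard, hBC])
  obtain ⟨f₁, hf₁⟩ := hex S (Pᶜ \ T) (by omega)
  obtain ⟨f₂, hf₂⟩ := hex (Pᶜ \ T) S (by omega)
  obtain ⟨f₃, hf₃⟩ := hex (P \ S) T (by omega)
  obtain ⟨f₄, hf₄⟩ := hex T (P \ S) (by omega)
  have m₁ : ∀ u ∈ S, f₁ u ∈ Pᶜ \ T := fun u hu => hf₁.mapsTo hu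
  have m₂ : ∀ u ∈ Pᶜ \ T, f₂ u ∈ S := fun u hu => hf₂.mapsTo hu
  have m₃ : ∀ u ∈ P \ S, f₃ u ∈ T := fun u hu => hf₃.mapsTo hu
  have m₄ : ∀ u ∈ T, f₄ u ∈ P \ S := fun u hu => hf₄.mapsTo hu
  obtain ⟨σ, hσ, hσm, hσn⟩ := exists_perm_of_injOn (P := P) h.bip
    (m := fun u => if u ∈ S then f₁ u else f₃ u) (n := fun u => if u ∈ T then f₄ u else f₂ u)
    (by
      intro u hu v hv huv
      have hu' : u ∈ P := hu
      have hv' : v ∈ P := hv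
      by_cases hu1 : u ∈ S <;> by_cases hv1 : v ∈ S <;>
        simp only [hu1, hv1, if_true, if_false] at huv
      · exact hf₁.injOn hu1 hv1 huv
      · have := m₁ u hu1
        rw [huv] at this
        exact absurd (m₃ v (mem_sdiff.2 ⟨hv', hv1⟩)) (mem_sdiff.1 this).2
      · have := m₁ v hv1
        rw [← huv] at this
        exact absurd (m₃ u (mem_sdiff.2 ⟨hu', hu1⟩)) (mem_sdiff.1 this).2
      · exact hf₃.injOn (mem_coe.2 (mem_sdiff.2 ⟨hu', hu1⟩)) (mem_coe.2 (mem_sdiff.2 ⟨hv', hv1⟩))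
          huv)
    (by
      intro u hu
      by_cases hu1 : u ∈ S
      · simpa [hu1] using (h1 u hu1 _ (m₁ u hu1)).1
      · simpa [hu1] using (h2 _ (m₃ u (mem_sdiff.2 ⟨hu, hu1⟩)) u (mem_sdiff.2 ⟨hu, hu1⟩)).1)
    (by
      intro u hu v hv huv
      have hu' : u ∈ Pᶜ := hu
      have hv' : v ∈ Pᶜ := hv
      by_cases hu1 : u ∈ T <;> by_cases hv1 : v ∈ T <;>
        simp only [hu1, hv1, if_true, if_false] at huv
      · exact hf₄.injOn hu1 hv1 huv
      · have := m₄ u hu1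
        rw [huv] at this
        exact absurd (m₂ v (mem_sdiff.2 ⟨hv', hv1⟩)) (mem_sdiff.1 this).2
      · have := m₄ v hv1
        rw [← huv] at this
        exact absurd (m₂ u (mem_sdiff.2 ⟨hu', hu1⟩)) (mem_sdiff.1 this).2
      · exact hf₂.injOn (mem_coe.2 (mem_sdiff.2 ⟨hu', hu1⟩)) (mem_coe.2 (mem_sdiff.2 ⟨hv', hv1⟩))
          huv)
    (by
      intro u hu
      rw [← mem_compl] at hu
      by_cases hu1 : u ∈ T
      · simpa [hu1] using (h2 u hu1 _ (m₄ u hu1)).2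
      · simpa [hu1] using (h1 _ (m₂ u (mem_sdiff.2 ⟨hu, hu1⟩)) u (mem_sdiff.2 ⟨hu, hu1⟩)).2)
  have hyP : y ∉ P := mem_compl.1 (hT hy)
  refine ⟨σ, hσ, S ∪ (Pᶜ \ T), ⟨x, mem_union_left _ hx⟩, fun he => ?_, fun v => ?_⟩
  · have := mem_univ y
    rw [← he, mem_union, mem_sdiff] at this
    rcases this with this | this
    · exact hyP (hS this)
    · exact this.2 hy
  · by_cases hv : v ∈ P
    · rw [hσm v hv]
      by_cases hv1 : v ∈ S
      · simp [hv1, mem_sdiff.1 (m₁ v hv1)]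
      · have h3 := m₃ v (mem_sdiff.2 ⟨hv, hv1⟩)
        have h4 : f₃ v ∉ S := fun h5 => mem_compl.1 (hT h3) (hS h5)
        simp [hv1, hv, h3, h4]
    · rw [hσn v hv]
      have hvS : v ∉ S := fun h5 => hv (hS h5)
      by_cases hv1 : v ∈ T
      · have h3 := mem_sdiff.1 (m₄ v hv1)
        simp [hv1, h3, hvS]
      · have h3 := m₂ v (mem_sdiff.2 ⟨mem_compl.2 hv, hv1⟩)
        simp [hv1, h3, hv]

/-- Either a near-perfect matching out of `P` extends the arc from `x` to `y`, or the digraph has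
a disconnected cycle factor. -/
theorem exists_matching_or_factor (h : DenseBip A P a k) {x y : V} (hx : x ∈ P) (hy : y ∉ P)
    (hxy : A x y) :
    (∃ m : V → V, Set.InjOn m P ∧ (∀ u ∈ P, A u (m u)) ∧ m x = y) ∨
    ∃ σ : Equiv.Perm V, (∀ v, A v (σ v)) ∧
      ∃ Q : Finset V, Q.Nonempty ∧ Q ≠ univ ∧ ∀ v, σ v ∈ Q ↔ v ∈ Q := by
  by_cases hall : ∀ s : Finset {u // u ∈ P.erase x},
      #s ≤ #(s.biUnion fun u => (outN A u.1).erase y)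
  · left
    obtain ⟨f, hf, hfm⟩ := (all_card_le_biUnion_card_iff_exists_injective _).1 hall
    have hfm' : ∀ u (hu : u ∈ P.erase x), f ⟨u, hu⟩ ≠ y ∧ A u (f ⟨u, hu⟩) := fun u hu => by
      simpa using hfm ⟨u, hu⟩
    refine ⟨fun u => if hu : u ∈ P.erase x then f ⟨u, hu⟩ else y, ?_, ?_, ?_⟩
    · intro u hu v hv huv
      have hu' : u ∈ P := hu
      have hv' : v ∈ P := hv
      by_cases hu1 : u ∈ P.erase x <;> by_cases hv1 : v ∈ P.erase x <;>
        simp only [hu1, hv1, dif_pos, dif_neg, not_false_eq_true] at huv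
      · simpa using hf huv
      · exact absurd huv (hfm' u hu1).1
      · exact absurd huv.symm (hfm' v hv1).1
      · simp only [mem_erase, not_and, hu', hv', not_true_eq_false, imp_false, not_not] at hu1 hv1
        rw [hu1, hv1]
    · intro u hu
      by_cases hu1 : u ∈ P.erase x
      · simpa only [hu1, dif_pos] using (hfm' u hu1).2
      · have : u = x := by by_contra hne; exact hu1 (mem_erase.2 ⟨hne, hu⟩)
        subst this
        simpa using hxy
    · simp
  · right
    push Not at hall
    obtain ⟨s, hs⟩ := hall
    set S : Finset V := s.map (Embedding.subtype _) with hSdef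
    set N : Finset V := s.biUnion fun u => (outN A u.1).erase y with hN
    have hSc : #S = #s := card_map _
    have hSP : S ⊆ P.erase x := by
      intro u hu
      simp only [hSdef, mem_map, Embedding.subtype_apply] at hu
      obtain ⟨b, -, rfl⟩ := hu
      exact b.2
    have hSP' : S ⊆ P := hSP.trans (erase_subset _ _)
    have hNP : N ⊆ Pᶜ.erase y := by
      intro w hw
      simp only [hN, mem_biUnion] at hw
      obtain ⟨b, -, hb⟩ := hw
      rw [mem_erase] at hb
      exact mem_erase.2 ⟨hb.1, h.outN_subset (mem_of_mem_erase b.2) hb.2⟩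
    have hTc : #((Pᶜ.erase y) \ N) = a - 1 - #N := by
      rw [card_sdiff_of_subset hNP, card_erase_of_mem (mem_compl.2 hy), h.card_right]
    have hSle : #S ≤ a - 1 := by
      have := card_le_card hSP
      rwa [card_erase_of_mem hx, h.card_left] at this
    have ha := h.two_mul_le
    have hk := h.one_lt
    have hT : (Pᶜ.erase y) \ N ⊆ Pᶜ := sdiff_subset.trans (erase_subset _ _)
    have hno : ∀ u ∈ S, ∀ w ∈ (Pᶜ.erase y) \ N, ¬ A u w := by
      intro u hu w hw huw
      simp only [hSdef, mem_map, Embedding.subtype_apply] at hu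
      obtain ⟨b, hb, rfl⟩ := hu
      rw [mem_sdiff, mem_erase] at hw
      refine hw.2 (mem_biUnion.2 ⟨b, hb, mem_erase.2 ⟨hw.1.1, mem_outN.2 huw⟩⟩)
    obtain ⟨h1, h2, h3⟩ := h.obstruction hSP' hT (card_pos.1 (by omega)) (card_pos.1 (by omega))
      hno (by omega)
    exact h.exists_factor_of_obstruction hSP' hT hno h1 h2 h3

theorem exists_factor (h : DenseBip A P a k) : ∃ σ : Equiv.Perm V, (∀ v, A v (σ v)) ∧
    ∃ Q : Finset V, Q.Nonempty ∧ Q ≠ univ ∧ ∀ v, σ v ∈ Q ↔ v ∈ Q := by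
  have hk := h.one_lt
  have h2k := h.two_mul_le
  obtain ⟨x, hx⟩ := card_pos.1 (show 0 < #P by rw [h.card_left]; omega)
  obtain ⟨y, hy⟩ : (outN A x ∩ inN A x).Nonempty := by
    by_contra hemp
    rw [not_nonempty_iff_eq_empty, ← disjoint_iff_inter_eq_empty] at hemp
    have h1 := card_le_card (union_subset (h.outN_subset hx) (h.inN_subset hx))
    have h2 := h.le_deg x
    rw [card_union_of_disjoint hemp, ← deg_eq_card, h.card_right] at h1
    omega
  simp only [mem_inter, mem_outN, mem_inN] at hy
  have hyP : y ∉ P := (h.bip _ _ hy.1).1 hx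
  rcases h.exists_matching_or_factor hx hyP hy.1 with ⟨m, hm, hmA, hmx⟩ | h1
  · rcases h.compl.exists_matching_or_factor (mem_compl.2 hyP) (by simpa using hx) hy.2 with
      ⟨n, hn, hnA, hny⟩ | h1
    · obtain ⟨σ, hσ, hσm, hσn⟩ := exists_perm_of_injOn h.bip hm hmA hn
        fun u hu => hnA u (mem_compl.2 hu)
      have hσx : σ x = y := (hσm x hx).trans hmx
      have hσy : σ y = x := (hσn y hyP).trans hny
      refine ⟨σ, hσ, {x, y}, ⟨x, by simp⟩, fun he => ?_, fun v => ?_⟩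
      · have h1 := h.card_left
        have h2 : #(P ∩ {x, y}) = a := by rw [he, inter_univ, h1]
        have h3 : P ∩ {x, y} ⊆ {x} := by
          intro z hz
          simp only [mem_inter, mem_insert, mem_singleton] at hz ⊢
          rcases hz with ⟨hz, rfl | rfl⟩
          · rfl
          · exact absurd hz hyP
        have h4 := card_le_card h3
        rw [card_singleton] at h4
        omega
      · simp only [mem_insert, mem_singleton]
        rw [← hσy, σ.injective.eq_iff, hσy, ← hσx, σ.injective.eq_iff, hσx, or_comm]
    · exact h1
  · exact h1

end DenseBip

end Factor

section Exchange

open scoped Classical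

theorem StronglyConnected.exists_arc_s12 {A : V → V → Prop} (hsc : StronglyConnected A) {Q : Finset V}
    {x y : V} (hx : x ∈ Q) (hy : y ∉ Q) : ∃ u ∈ Q, ∃ w ∉ Q, A u w := by
  by_contra! hno
  have : ∀ z, Relation.ReflTransGen A x z → z ∈ Q := by
    intro z hz
    induction hz with
    | refl => exact hx
    | tail _ hbc ih => by_contra hc; exact hno _ ih _ hc hbc
  exact hy (this y (hsc x y))

theorem swap_apply_mem_iff {p q : V} {Q : Finset V} (hpq : p ∈ Q ↔ q ∈ Q) (x : V) :
    Equiv.swap p q x ∈ Q ↔ x ∈ Q := by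
  rw [Equiv.swap_apply_def]
  split_ifs with h1 h2
  · rw [h1, hpq]
  · rw [h2, hpq]
  · rfl

theorem inv_apply_mem_iff {π : Equiv.Perm V} {Q : Finset V} (hπ : ∀ x, π x ∈ Q ↔ x ∈ Q) (x : V) :
    π⁻¹ x ∈ Q ↔ x ∈ Q := by
  rw [← hπ (π⁻¹ x)]; simp

theorem IsOrbit.conj {σ π : Equiv.Perm V} {C : Finset V} (hC : IsOrbit σ C)
    (hπ : ∀ x, π x ∈ C ↔ x ∈ C) : IsOrbit (π * σ * π⁻¹) C := by
  refine ⟨hC.1, fun x hx y => ?_⟩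
  rw [Equiv.Perm.sameCycle_conj, ← hC.2 _ ((inv_apply_mem_iff hπ x).2 hx), inv_apply_mem_iff hπ]

variable [Fintype V] {A : V → V → Prop} {P : Finset V} {a k : ℕ}

namespace DenseBip

theorem exists_cross_arcs (h : DenseBip A P a k) (hsc : StronglyConnected A) {C : Finset V}
    (ha : a = 2 * k) (hC : #(C ∩ P) = k) (hC' : #(C ∩ Pᶜ) = k) {x : V} (hx : x ∉ C) :
    ∃ u ∈ C, ∃ w ∉ C, ∃ v ∉ C, ∃ z ∈ C, A u w ∧ A v z ∧ (u ∈ P ↔ v ∈ P) := by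
  have hk := h.one_lt
  obtain ⟨c, hc⟩ := card_pos.1 (show 0 < #(C ∩ P) by omega)
  obtain ⟨c', hc'⟩ := card_pos.1 (show 0 < #(C ∩ Pᶜ) by omega)
  rw [mem_inter] at hc hc'
  obtain ⟨u, hu, w, hw, huw⟩ := hsc.exists_arc_s12 hc.1 hx
  obtain ⟨v, hv, z, hz, hvz⟩ := hsc.exists_arc_s12 (Q := Cᶜ) (mem_compl.2 hx) (by simpa using hc.1)
  rw [mem_compl] at hv
  rw [mem_compl, not_not] at hz
  by_contra! hno
  have hpar := hno u hu w hw v hv z hz huw hvz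
  obtain ⟨y, hy, hyP⟩ : ∃ y ∈ C, (y ∈ P ↔ v ∈ P) := by
    by_cases hvP : v ∈ P
    · exact ⟨c, hc.1, by tauto⟩
    · exact ⟨c', hc'.1, by have := mem_compl.1 hc'.2; tauto⟩
  have hbound : #(C ∩ univ.filter fun t => t ∈ P ↔ y ∉ P) = k := by
    by_cases hyP : y ∈ P
    · rw [← hC']; congr 1; ext t; simp [hyP]
    · rw [← hC]; congr 1; ext t; simp [hyP]
  have h1 : outN A y ⊆ C ∩ univ.filter fun t => t ∈ P ↔ y ∉ P := by
    intro t ht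
    rw [mem_outN] at ht
    have := h.bip _ _ ht
    simp only [mem_inter, mem_filter, mem_univ, true_and]
    refine ⟨?_, by tauto⟩
    by_contra htC
    have := hno y hy t htC v hv z hz ht hvz
    tauto
  have h2 : inN A y ⊆ C ∩ univ.filter fun t => t ∈ P ↔ y ∉ P := by
    intro t ht
    rw [mem_inN] at ht
    have := h.bip _ _ ht
    simp only [mem_inter, mem_filter, mem_univ, true_and]
    refine ⟨?_, by tauto⟩
    by_contra htC
    have := hno u hu w hw t htC y hy huw ht
    tauto
  have h3 := card_le_card h1
  have h4 := card_le_card h2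
  have h5 := h.le_deg y
  rw [deg_eq_card] at h5
  omega

/-- After conjugating by a permutation preserving `C`, a cycle factor admits an exchange between
`C` and its complement. -/
theorem exists_exchange (h : DenseBip A P a k) (hsc : StronglyConnected A) {σ : Equiv.Perm V}
    (hσ : ∀ v, A v (σ v)) {C : Finset V} (hC : ∀ x, σ x ∈ C ↔ x ∈ C) (hne : C.Nonempty)
    (hnu : C ≠ univ) {j : ℕ} (hj : Odd j) :
    ∃ π : Equiv.Perm V, (∀ x, π x ∈ C ↔ x ∈ C) ∧ (∀ v, A v ((π * σ * π⁻¹) v)) ∧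
      ∃ u ∈ C, ∃ v ∉ C, A u ((π * σ * π⁻¹) v) ∧ A v (((π * σ * π⁻¹) ^ j) u) := by
  by_cases hex : ∃ u ∈ C, ∃ v ∉ C, A u (σ v) ∧ A v ((σ ^ j) u)
  · exact ⟨1, by simp, by simpa using hσ, by simpa using hex⟩
  push Not at hex
  have hP : ∀ x, σ x ∈ P ↔ x ∉ P := fun x => by
    have := h.bip _ _ (hσ x)
    tauto
  have hP2 : ∀ n x, (σ ^ (2 * n)) x ∈ P ↔ x ∈ P := by
    intro n x
    rw [pow_mul]
    refine pow_apply_mem_iff (fun x => ?_) n x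
    rw [pow_two, Equiv.Perm.mul_apply, hP, hP, not_not]
  have hPj : ∀ x, (σ ^ j) x ∈ P ↔ x ∉ P := by
    intro x
    obtain ⟨n, rfl⟩ := hj
    rw [pow_succ, Equiv.Perm.mul_apply, hP2, hP]
  have hCj := pow_apply_mem_iff hC j
  have hs := card_inter_eq_card_inter_compl (C := C) (fun z _ => hσ z) hC h.bip
  have hsum : ∀ Q : Finset V, #(C ∩ Q) + #(Cᶜ ∩ Q) = #Q := fun Q => by
    rw [inter_comm C, inter_comm Cᶜ, ← sdiff_eq_inter_compl, card_inter_add_card_sdiff]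
  have hsP := hsum P
  have hsP' := hsum Pᶜ
  rw [h.card_left] at hsP
  rw [h.card_right] at hsP'
  have hcc : ∀ Q : Finset V, #Q = #(Q ∩ P) + #(Q ∩ Pᶜ) := fun Q => by
    rw [← sdiff_eq_inter_compl, card_inter_add_card_sdiff]
  have hpos : 0 < #(C ∩ P) := by
    have := hcc C
    have := card_pos.2 hne
    omega
  obtain ⟨x, hx⟩ : ∃ x, x ∉ C := by
    by_contra! hall
    exact hnu (eq_univ_iff_forall.2 hall)
  have hpos' : 0 < #(Cᶜ ∩ P) := by
    have := hcc Cᶜ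
    have := card_pos.2 ⟨x, mem_compl.2 hx⟩
    omega
  have hex' : ∀ u ∈ Cᶜ, ∀ v ∉ Cᶜ, A u ((σ ^ j) v) → ¬ A v (σ u) := by
    intro u hu v hv huv hvu
    exact hex v (by simpa using hv) u (by simpa using hu) hvu huv
  have key : 2 * #(C ∩ P) ≤ a → a = 2 * k ∧ #(C ∩ P) = k ∧
      ∀ u ∈ C, ∀ w ∈ C, (u ∈ P ↔ w ∉ P) → A u w := fun hle =>
    h.complete_of_no_exchange rfl hs.symm hpos hle hC hP hCj hPj hex
  have key' : 2 * #(Cᶜ ∩ P) ≤ a → a = 2 * k ∧ #(Cᶜ ∩ P) = k ∧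
      ∀ u ∈ Cᶜ, ∀ w ∈ Cᶜ, (u ∈ P ↔ w ∉ P) → A u w := fun hle =>
    h.complete_of_no_exchange rfl (by omega) hpos' hle
      (fun x => by simp only [mem_compl, hCj]) hPj (fun x => by simp only [mem_compl, hC]) hP hex'
  obtain ⟨ha, hk1, hk2⟩ : a = 2 * k ∧ #(C ∩ P) = k ∧ #(Cᶜ ∩ P) = k := by
    rcases le_total (2 * #(C ∩ P)) a with hle | hle
    · have := key hle
      omega
    · have := key' (by omega)
      omega
  have hcomp := (key (by omega)).2.2
  have hcomp' := (key' (by omega)).2.2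
  obtain ⟨u, hu, w, hw, v, hv, z, hz, huw, hvz, huv⟩ :=
    h.exists_cross_arcs hsc ha hk1 (hs ▸ hk1) hx
  have hwP := h.bip _ _ huw
  have hzP := h.bip _ _ hvz
  replace hwP : w ∈ P ↔ u ∉ P := by tauto
  replace hzP : z ∈ P ↔ u ∉ P := by tauto
  have hσvP : σ v ∈ P ↔ u ∉ P := by rw [hP, huv]
  have hτuP := hPj u
  have hσvC : σ v ∉ C := fun hc => hv ((hC v).1 hc)
  have hτuC := (hCj u).2 hu
  set π : Equiv.Perm V := Equiv.swap (σ v) w * Equiv.swap ((σ ^ j) u) z with hπ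
  have hπC : ∀ x, π x ∈ C ↔ x ∈ C := fun x => by
    rw [hπ, Equiv.Perm.mul_apply, swap_apply_mem_iff (iff_of_false hσvC hw),
      swap_apply_mem_iff (iff_of_true hτuC hz)]
  have hπP : ∀ x, π x ∈ P ↔ x ∈ P := fun x => by
    rw [hπ, Equiv.Perm.mul_apply, swap_apply_mem_iff (hσvP.trans hwP.symm),
      swap_apply_mem_iff (hτuP.trans hzP.symm)]
  have hne : ∀ t p, (t ∈ P ↔ u ∈ P) → (p ∈ P ↔ u ∉ P) → t ≠ p := by
    rintro t p ht hp rfl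
    exact iff_not_self (ht.symm.trans hp)
  have hfix : ∀ t, (t ∈ P ↔ u ∈ P) → π t = t := fun t ht => by
    rw [hπ, Equiv.Perm.mul_apply,
      Equiv.swap_apply_of_ne_of_ne (hne t _ ht hτuP) (hne t _ ht hzP),
      Equiv.swap_apply_of_ne_of_ne (hne t _ ht hσvP) (hne t _ ht hwP)]
  have hπv : π (σ v) = w := by
    rw [hπ, Equiv.Perm.mul_apply, Equiv.swap_apply_of_ne_of_ne (a := (σ ^ j) u)
      (ne_of_mem_of_not_mem hτuC hσvC).symm (ne_of_mem_of_not_mem hz hσvC).symm,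
      Equiv.swap_apply_left]
  have hπu : π ((σ ^ j) u) = z := by
    rw [hπ, Equiv.Perm.mul_apply, Equiv.swap_apply_left, Equiv.swap_apply_of_ne_of_ne
      (ne_of_mem_of_not_mem hz hσvC) (ne_of_mem_of_not_mem hz hw)]
  have hfix' : ∀ t, (t ∈ P ↔ u ∈ P) → π⁻¹ t = t := fun t ht => by
    rw [Equiv.Perm.inv_eq_iff_eq, hfix t ht]
  refine ⟨π, hπC, fun y => ?_, u, hu, v, hv, ?_, ?_⟩
  · have h1 : (π * σ * π⁻¹) y ∈ C ↔ y ∈ C := by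
      rw [Equiv.Perm.mul_apply, Equiv.Perm.mul_apply, hπC, hC, inv_apply_mem_iff hπC]
    have h2 : (π * σ * π⁻¹) y ∈ P ↔ y ∉ P := by
      rw [Equiv.Perm.mul_apply, Equiv.Perm.mul_apply, hπP, hP, inv_apply_mem_iff hπP]
    by_cases hy : y ∈ C
    · exact hcomp y hy _ (h1.2 hy) (by rw [h2, not_not])
    · exact hcomp' y (mem_compl.2 hy) _ (mem_compl.2 fun hc => hy (h1.1 hc)) (by rw [h2, not_not])
  · rwa [Equiv.Perm.mul_apply, Equiv.Perm.mul_apply, hfix' v huv.symm, hπv]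
  · rwa [conj_pow, Equiv.Perm.mul_apply, Equiv.Perm.mul_apply, hfix' u Iff.rfl, hπu]

theorem card_univ (h : DenseBip A P a k) : #(univ : Finset V) = 2 * a := by
  have := card_add_card_compl P
  rw [h.card_left, h.card_right] at this
  rw [Finset.card_univ]
  omega

theorem exists_two_orbits (h : DenseBip A P a k) (hsc : StronglyConnected A) :
    HasCycleOfLength A (2 * a) ∧ ∃ (σ : Equiv.Perm V) (C : Finset V), (∀ v, A v (σ v)) ∧
      IsOrbit σ C ∧ IsOrbit σ Cᶜ := by
  obtain ⟨⟨σ, C⟩, ⟨hσ, hC, hCu⟩, hmax⟩ := Set.exists_max_image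
    {q : Equiv.Perm V × Finset V | (∀ v, A v (q.1 v)) ∧ IsOrbit q.1 q.2 ∧ q.2 ≠ univ}
    (fun q => #q.2) (Set.toFinite _) (by
      obtain ⟨σ, hσ, Q, ⟨x, hx⟩, hQu, hQ⟩ := h.exists_factor
      obtain ⟨C, hC, hxC⟩ := exists_isOrbit σ x
      refine ⟨(σ, C), hσ, hC, ?_⟩
      rintro rfl
      exact hQu (univ_subset_iff.1 (hC.subset_of_inter hxC hx hQ)))
  obtain ⟨π, hπ, hσ', u, hu, v, hv, huv, hvu⟩ :=
    h.exists_exchange hsc hσ hC.apply_mem_iff hC.1 hCu odd_one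
  have hC' := hC.conj hπ
  generalize π * σ * π⁻¹ = τ at hσ' huv hvu hC'
  rw [pow_one] at hvu
  have hnot : ¬ τ.SameCycle u v := fun hs => hv ((hC'.2 u hu v).2 hs)
  have hg : ∀ x, A x ((τ * Equiv.swap u v) x) := by
    intro x
    rw [Equiv.Perm.mul_apply, Equiv.swap_apply_def]
    split_ifs with h1 h2
    · exact h1 ▸ huv
    · exact h2 ▸ hvu
    · exact hσ' x
  obtain ⟨O, hO, huO⟩ := exists_isOrbit (τ * Equiv.swap u v) u
  have hCO : C ⊆ O := fun z hz =>
    (hO.2 u huO z).2 (sameCycle_mul_swap_union hnot (Or.inl ((hC'.2 u hu z).1 hz)))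
  have hvO : v ∈ O :=
    (hO.2 u huO v).2 (sameCycle_mul_swap_union hnot (Or.inr (Equiv.Perm.SameCycle.refl _ _)))
  have hOu : O = univ := by
    by_contra hOu
    have h1 := hmax (τ * Equiv.swap u v, O) ⟨hg, hO, hOu⟩
    have h2 := card_lt_card (Finset.ssubset_iff_subset_ne.2 ⟨hCO, fun he => hv (he ▸ hvO)⟩)
    exact absurd h1 (not_le.2 h2)
  refine ⟨?_, τ, C, hσ', hC', ?_⟩
  · rw [← h.card_univ, ← hOu]
    exact hO.hasCycleOfLength fun z _ => hg z
  · obtain ⟨D, hD, hvD⟩ := exists_isOrbit τ v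
    have hinv : ∀ y, (τ * Equiv.swap u v) y ∈ C ∪ D ↔ y ∈ C ∪ D := by
      intro y
      rw [Equiv.Perm.mul_apply, mem_union, hC'.apply_mem_iff, hD.apply_mem_iff, ← mem_union]
      refine swap_apply_mem_iff ?_ y
      simp [hu, hvD]
    have hsub := hO.subset_of_inter huO (mem_union_left D hu) hinv
    have hDC : D = Cᶜ := by
      ext y
      have hy : y ∈ C ∪ D := hsub (hOu ▸ mem_univ y)
      rw [mem_union] at hy
      rw [mem_compl]
      refine ⟨fun hyD hyC => hv ?_, fun hyC => hy.resolve_left hyC⟩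
      exact (hC'.2 y hyC v).2 ((hD.2 y hyD v).1 hvD)
    exact hDC ▸ hD

theorem exists_long_orbit (h : DenseBip A P a k) (hsc : StronglyConnected A) {σ : Equiv.Perm V}
    {C : Finset V} (hσ : ∀ v, A v (σ v)) (hC : IsOrbit σ C) (hC' : IsOrbit σ Cᶜ) :
    ∃ (g : Equiv.Perm V) (O : Finset V), IsOrbit g O ∧ (∀ z ∈ O, A z (g z)) ∧
      #O + 2 = 2 * a := by
  have hCu : C ≠ univ := by
    rintro rfl
    simpa using hC'.1
  obtain ⟨π, hπ, hσ', u, hu, v, hv, huv, hvu⟩ :=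
    h.exists_exchange hsc hσ hC.apply_mem_iff hC.1 hCu (j := 3) (by decide)
  replace hC := hC.conj hπ
  replace hC' := hC'.conj (π := π) fun x => by simp only [mem_compl, hπ]
  generalize π * σ * π⁻¹ = τ at hσ' huv hvu hC hC'
  have hne : ∀ x, τ x ≠ x := fun x hx => by
    have h1 := h.bip _ _ (hσ' x)
    rw [hx] at h1
    tauto
  have hcard := h.card_univ
  have hp : τ u ∈ C := (hC.apply_mem_iff u).2 hu
  have hq : τ (τ u) ∈ C := (hC.apply_mem_iff _).2 hp
  by_cases hqu : τ (τ u) = u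
  · refine ⟨τ, Cᶜ, hC', fun z _ => hσ' z, ?_⟩
    have h1 : #C ≤ 2 := by
      rw [hC.card_eq hu]
      exact IsPeriodicPt.minimalPeriod_le two_pos hqu
    have h2 : 2 ≤ #C := by
      rw [← card_pair (hne u).symm]
      refine card_le_card fun z hz => ?_
      rw [mem_insert, mem_singleton] at hz
      rcases hz with rfl | rfl <;> assumption
    have h3 := card_add_card_compl C
    rw [Finset.card_univ] at hcard
    omega
  have hpq := hne (τ u)
  have hpu := hne u
  have hvu' : v ≠ u := fun he => hv (he ▸ hu)
  have hvp : v ≠ τ u := fun he => hv (he ▸ hp)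
  have hvq : v ≠ τ (τ u) := fun he => hv (he ▸ hq)
  set g₁ := τ * Equiv.swap u (τ u) with hg₁
  have hg₁u : g₁ u = τ (τ u) := by simp [hg₁]
  have hg₁p : g₁ (τ u) = τ u := by simp [hg₁]
  have hg₁' : ∀ z, z ≠ u → z ≠ τ u → g₁ z = τ z := fun z h1 h2 => by
    rw [hg₁, Equiv.Perm.mul_apply, Equiv.swap_apply_of_ne_of_ne h1 h2]
  set g₂ := g₁ * Equiv.swap u (g₁ u) with hg₂
  have hg₂u : g₂ u = τ (τ (τ u)) := by
    rw [hg₂, Equiv.Perm.mul_apply, Equiv.swap_apply_left, hg₁u, hg₁' _ hqu hpq]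
  have hg₂q : g₂ (τ (τ u)) = τ (τ u) := by
    rw [hg₂, hg₁u, Equiv.Perm.mul_apply, Equiv.swap_apply_right, hg₁u]
  have hg₂p : g₂ (τ u) = τ u := by
    rw [hg₂, hg₁u, Equiv.Perm.mul_apply, Equiv.swap_apply_of_ne_of_ne hpu hpq.symm, hg₁p]
  have hg₂' : ∀ z, z ≠ u → z ≠ τ u → z ≠ τ (τ u) → g₂ z = τ z := fun z h1 h2 h3 => by
    rw [hg₂, hg₁u, Equiv.Perm.mul_apply, Equiv.swap_apply_of_ne_of_ne h1 h3, hg₁' z h1 h2]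
  have hg₂C' : ∀ z ∉ C, g₂ z = τ z := fun z hz =>
    hg₂' z (fun he => hz (he ▸ hu)) (fun he => hz (he ▸ hp)) (fun he => hz (he ▸ hq))
  have hg₂C : ∀ z, g₂ z ∈ Cᶜ ↔ z ∈ Cᶜ := by
    intro z
    rw [hg₂, hg₁, Equiv.Perm.mul_apply, Equiv.Perm.mul_apply, hC'.apply_mem_iff,
      swap_apply_mem_iff, swap_apply_mem_iff]
    · simp [hu, hq]
    · simp [hu, hp]
  have hin : ∀ z ∈ C, z ≠ τ u → z ≠ τ (τ u) → g₂.SameCycle u z := fun z hz h1 h2 =>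
    sameCycle_bypass (sameCycle_bypass ((hC.2 u hu z).1 hz) h1) (by rw [hg₁u]; exact h2)
  have hvc := mem_compl.2 hv
  have hpow : ∀ n : ℕ, (g₂ ^ n) v = (τ ^ n) v := by
    intro n
    induction n with
    | zero => rfl
    | succ n ih =>
      rw [pow_succ', pow_succ', Equiv.Perm.mul_apply g₂, Equiv.Perm.mul_apply τ, ih,
        hg₂C' _ (mem_compl.1 ((pow_apply_mem_iff hC'.apply_mem_iff n v).2 hvc))]
  have hout : ∀ z ∉ C, g₂.SameCycle v z := by
    intro z hz
    obtain ⟨n, hn⟩ := ((hC'.2 v hvc z).1 (mem_compl.2 hz)).exists_nat_pow_eq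
    exact ⟨n, by rw [zpow_natCast, hpow, hn]⟩
  have hnot : ¬ g₂.SameCycle u v := by
    intro hs
    obtain ⟨n, hn⟩ := hs.symm.exists_nat_pow_eq
    have := (pow_apply_mem_iff hg₂C n v).2 hvc
    rw [hn, mem_compl] at this
    exact this hu
  have hg_fix : ∀ z, z = τ u ∨ z = τ (τ u) → (g₂ * Equiv.swap u v) z = z := by
    rintro z (rfl | rfl)
    · rw [Equiv.Perm.mul_apply, Equiv.swap_apply_of_ne_of_ne hpu hvp.symm, hg₂p]
    · rw [Equiv.Perm.mul_apply, Equiv.swap_apply_of_ne_of_ne hqu hvq.symm, hg₂q]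
  refine ⟨g₂ * Equiv.swap u v, {τ u, τ (τ u)}ᶜ, isOrbit_of_forall (x := u) ?_ fun y => ?_,
    fun z hz => ?_, ?_⟩
  · simp only [mem_compl, mem_insert, mem_singleton, not_or]
    exact ⟨hpu.symm, fun he => hqu he.symm⟩
  · simp only [mem_compl, mem_insert, mem_singleton]
    constructor
    · intro hy
      rw [not_or] at hy
      refine sameCycle_mul_swap_union hnot ?_
      by_cases hyC : y ∈ C
      · exact Or.inl (hin y hyC hy.1 hy.2)
      · exact Or.inr (hout y hyC)
    · intro hs hy
      have he : u = y := hs.eq_of_right (hg_fix y hy)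
      subst he
      rcases hy with hy | hy
      · exact hpu hy.symm
      · exact hqu hy.symm
  · simp only [mem_compl, mem_insert, mem_singleton, not_or] at hz
    rw [Equiv.Perm.mul_apply, Equiv.swap_apply_def]
    split_ifs with h1 h2
    · rw [hg₂C' v hv, h1]
      exact huv
    · rw [hg₂u, h2]
      exact hvu
    · rw [hg₂' z h1 hz.1 hz.2]
      exact hσ' z
  · have h1 := card_add_card_compl ({τ u, τ (τ u)} : Finset V)
    rw [card_pair hpq.symm] at h1
    rw [Finset.card_univ] at hcard
    omega

theorem bipancyclic (h : DenseBip A P a k) (hsc : StronglyConnected A) : Bipancyclic A a := by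
  obtain ⟨hham, σ, C, hσ, hC, hC'⟩ := h.exists_two_orbits hsc
  obtain ⟨g, O, hO, hgA, hcard⟩ := h.exists_long_orbit hsc hσ hC hC'
  intro l hl hla
  rcases eq_or_lt_of_le hla with rfl | hlt
  · exact hham
  have hOc : #Oᶜ = 2 := by
    have h1 := card_add_card_compl O
    have h2 := h.card_univ
    rw [Finset.card_univ] at h2
    omega
  obtain ⟨v, hv⟩ := card_pos.1 (show 0 < #Oᶜ by omega)
  have hcomp : #(O ∩ P) = #(O ∩ Pᶜ) :=
    card_inter_eq_card_inter_compl hgA hO.apply_mem_iff h.bip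
  have hsum : #(O ∩ P) + #(O ∩ Pᶜ) = #O := by
    rw [← sdiff_eq_inter_compl, card_inter_add_card_sdiff]
  have hk := h.one_lt
  have hirr : ¬ A v v := fun hvv => by
    have := h.bip _ _ hvv
    tauto
  have hv1 : #(Oᶜ.erase v) = 1 := by rw [card_erase_of_mem hv, hOc]
  have hout : #(outN A v \ O) ≤ 1 := by
    rw [← hv1]
    refine card_le_card fun w hw => ?_
    rw [mem_sdiff, mem_outN] at hw
    exact mem_erase.2 ⟨fun he => hirr (he ▸ hw.1), mem_compl.2 hw.2⟩
  have hin : #(inN A v \ O) ≤ 1 := by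
    rw [← hv1]
    refine card_le_card fun w hw => ?_
    rw [mem_sdiff, mem_inN] at hw
    exact mem_erase.2 ⟨fun he => hirr (he ▸ hw.1), mem_compl.2 hw.2⟩
  have hd := h.le_deg v
  rw [deg_eq_card, ← card_inter_add_card_sdiff (outN A v) O,
    ← card_inter_add_card_sdiff (inN A v) O] at hd
  refine hO.hasCycleOfLength_of_notMem (m := a - 1) hgA h.bip (mem_compl.1 hv) ?_ (by omega)
    (by omega) hl (by omega)
  by_cases hvP : v ∈ P
  · rw [show (univ.filter fun w => w ∈ P ↔ v ∉ P) = Pᶜ by ext w; simp [hvP]]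
    omega
  · rw [show (univ.filter fun w => w ∈ P ↔ v ∉ P) = P by ext w; simp [hvP]]
    omega

end DenseBip

end Exchange

section Main

open scoped Classical

variable [Fintype V] {A : V → V → Prop}

/-- A strongly connected digraph without dominated pairs is a directed cycle. -/
theorem isDirectedCycleDigraph_of_no_dominatedPair (hsc : StronglyConnected A)
    (hcard : 1 < Fintype.card V) (hno : ∀ u v, ¬ IsDominatedPair A u v) :
    IsDirectedCycleDigraph A := by
  have hout : ∀ u, ∃ v, A u v := by
    intro u
    have : Nontrivial V := Fintype.one_lt_card_iff_nontrivial.1 hcard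
    obtain ⟨v, hv⟩ := exists_ne u
    rcases (hsc u v).cases_head with h1 | ⟨w, hw, -⟩
    · exact absurd h1.symm hv
    · exact ⟨w, hw⟩
  have hin : ∀ v, ∃ u, A u v := by
    intro v
    have : Nontrivial V := Fintype.one_lt_card_iff_nontrivial.1 hcard
    obtain ⟨u, hu⟩ := exists_ne v
    rcases (hsc u v).cases_tail with h1 | ⟨w, -, hw⟩
    · exact absurd h1.symm hu
    · exact ⟨w, hw⟩
  choose g hg using hout
  have huniq : ∀ u v, A u v → g u = v := by
    intro u v huv
    by_contra hne
    exact hno (g u) v ⟨hne, u, hg u, huv⟩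
  have hsurj : Surjective g := fun v => (hin v).imp fun u hu => huniq u v hu
  let σ : Equiv.Perm V := Equiv.ofBijective g (Finite.surjective_iff_bijective.1 hsurj)
  have hσ : ∀ u, σ u = g u := fun _ => rfl
  obtain ⟨x⟩ : Nonempty V := Fintype.card_pos_iff.1 (by omega)
  have hall : ∀ y, σ.SameCycle x y := by
    intro y
    induction hsc x y with
    | refl => exact Equiv.Perm.SameCycle.refl _ _
    | tail _ hbc ih =>
      rw [← huniq _ _ hbc, ← hσ]
      exact Equiv.Perm.sameCycle_apply_right.2 ih
  have hO : IsOrbit σ univ := isOrbit_of_forall (mem_univ x) fun y => by simp [hall y]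
  have hc := hO.hasCycleOfLength (A := A) fun z _ => hg z
  rw [Finset.card_univ] at hc
  obtain ⟨f, hf, hfA⟩ := hc
  have : NeZero (Fintype.card V) := ⟨by omega⟩
  have hfb : Bijective f :=
    (Fintype.bijective_iff_injective_and_card f).2 ⟨hf, ZMod.card _⟩
  refine ⟨Equiv.ofBijective f hfb, fun u v => ⟨fun huv => ?_, ?_⟩⟩
  · obtain ⟨i, rfl⟩ := hfb.2 u
    exact ⟨i, rfl, (huniq _ _ huv).symm.trans (huniq _ _ (hfA i))⟩
  · rintro ⟨i, rfl, rfl⟩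
    exact hfA i

end Main

/-- condition (B_k) on dominated pairs implies bipancyclicity or a `2a`-cycle. -/
theorem stmt_12 {V : Type*} [Fintype V] (A : V → V → Prop) (a k : ℕ) (X Y : Set V)
    (ha : 3 ≤ a) (hk1 : 1 < k) (hk2 : a < 4 * k) (hk3 : 2 * k ≤ a)
    (hcard : Fintype.card V = 2 * a)
    (hbip : IsBipartition A X Y) (hX : X.ncard = a) (hY : Y.ncard = a)
    (hsc : StronglyConnected A)
    (hdeg : ∀ u v : V, IsDominatedPair A u v →
      (2 * a - k ≤ deg A u ∧ a + k ≤ deg A v) ∨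
      (a + k ≤ deg A u ∧ 2 * a - k ≤ deg A v)) :
    Bipancyclic A a ∨ IsDirectedCycleDigraph A := by
  classical
  by_cases hno : ∀ u v, ¬ IsDominatedPair A u v
  · exact Or.inr (isDirectedCycleDigraph_of_no_dominatedPair hsc (by omega) hno)
  left
  push Not at hno
  obtain ⟨u₀, v₀, h₀⟩ := hno
  obtain ⟨hdisj, hunion, harc⟩ := hbip
  have hYX : ∀ v, v ∈ Y ↔ v ∉ X := by
    intro v
    have h1 : v ∈ X ∪ Y := hunion ▸ Set.mem_univ v
    exact ⟨fun hv hx => Set.disjoint_left.1 hdisj hx hv, fun hv => h1.resolve_left hv⟩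
  have hbip' : ∀ u v, A u v → (u ∈ X.toFinset ↔ v ∉ X.toFinset) := by
    intro u v huv
    have := harc u v huv
    simp only [Set.mem_toFinset]
    rw [hYX, hYX] at this
    tauto
  have hXc : #X.toFinset = a := by rw [← hX, Set.ncard_eq_toFinset_card']
  have hXc' : #X.toFinsetᶜ = a := by
    have := card_add_card_compl X.toFinset
    omega
  have hin : ∀ u, #(inN A u) ≤ a := by
    intro u
    by_cases hu : u ∈ X.toFinset
    · rw [← hXc']
      refine card_le_card fun w hw => mem_compl.2 fun hwX => ?_
      exact (hbip' w u (mem_inN.1 hw)).1 hwX hu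
    · rw [← hXc]
      refine card_le_card fun w hw => ?_
      exact (hbip' w u (mem_inN.1 hw)).2 hu
  have hdom : ∀ u v, IsDominatedPair A u v → a + k ≤ deg A u := by
    intro u v huv
    rcases hdeg u v huv with h1 | h1 <;> omega
  have hstep : ∀ u v, (∃ w, IsDominatedPair A u w) → A u v → ∃ w, IsDominatedPair A v w := by
    rintro u v ⟨w, huw⟩ huv
    have h1 := hdom u w huw
    have h2 := hin u
    rw [deg_eq_card] at h1
    have h3 : 1 < #(outN A u) := by omega
    obtain ⟨w', hw', hne⟩ := exists_mem_ne h3 v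
    exact ⟨w', hne.symm, u, huv, mem_outN.1 hw'⟩
  have hall : ∀ v, ∃ w, IsDominatedPair A v w := by
    intro v
    induction hsc u₀ v with
    | refl => exact ⟨v₀, h₀⟩
    | tail _ hbc ih => exact hstep _ _ ih hbc
  have hD : DenseBip A X.toFinset a k :=
    { one_lt := hk1
      lt_four_mul := hk2
      two_mul_le := hk3
      card_left := hXc
      card_right := hXc'
      bip := hbip'
      le_deg := fun v => (hall v).elim fun w hw => hdom v w hw
      high := fun u v w hne hu hv => (hdeg u v ⟨hne, w, hu, hv⟩).imp And.left And.right }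
  exact hD.bipancyclic hsc
end
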